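/- Let L be a left Hopf algebroid over B. The map Ad^L: B^∨(L) → Aut(L), σ ↦ (Ad^L_σ, σ∘s) with Ad^L_σ(X) := s(σ(X₍₁₎)) X₍₂₎₊ t(σ(X₍₂₎₋)), together with the tautological action (Φ,φ) ▷ σ := φ∘σ∘Φ⁻¹ of Aut(L) on the group B^∨(L) of left bisections, makes the pair (B^∨(L), Aut(L)) into a 2-group. -/

import Mathlib

open scoped TensorProduct
open TensorProduct

noncomputable section
attribute [local instance] Classical.propDecidable

/-- Choice-based lift of a (bilinear) function to the tensor product: if a linear map agreeing
with `f` on pure tensors exists, this is it (it is then unique); otherwise `0`. -/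
def tlift (R : Type*) [CommRing R] {M N Q : Type*} [AddCommGroup M] [Module R M]
    [AddCommGroup N] [Module R N] [AddCommGroup Q] [Module R Q]
    (f : M → N → Q) : M ⊗[R] N →ₗ[R] Q :=
  if h : ∃ F : M ⊗[R] N →ₗ[R] Q, ∀ x y, F (x ⊗ₜ[R] y) = f x y then h.choose else 0

/-- Choice-based lift of a (bilinear, balanced) function to a quotient of the tensor product. -/
def qtlift (R : Type*) [CommRing R] {M N Q : Type*} [AddCommGroup M] [Module R M]
    [AddCommGroup N] [Module R N] [AddCommGroup Q] [Module R Q]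
    (p : Submodule R (M ⊗[R] N)) (f : M → N → Q) : ((M ⊗[R] N) ⧸ p) →ₗ[R] Q :=
  if h : ∃ F : ((M ⊗[R] N) ⧸ p) →ₗ[R] Q,
      ∀ x y, F (Submodule.Quotient.mk (x ⊗ₜ[R] y)) = f x y then h.choose else 0

variable (k : Type*) [Field k]

/-- Source and target data for a left bialgebroid over `B`: an algebra map `s : B → L` and an
anti-algebra map `t : B → L` with commuting ranges. -/
structure BgdST (B L : Type*) [Ring B] [Algebra k B] [Ring L] [Algebra k L] where
  s : B →ₐ[k] L
  t : B →ₗ[k] L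
  t_one : t 1 = 1
  t_mul : ∀ a b : B, t (a * b) = t b * t a
  st_comm : ∀ a b : B, s a * t b = t b * s a

namespace BgdST

variable {k} {B L : Type*} [Ring B] [Algebra k B] [Ring L] [Algebra k L]
variable (st : BgdST k B L)

/-- The relations defining `L ⊗_B L`: `t a · X ⊗ Y  ~  X ⊗ s a · Y`. -/
def rel : Submodule k (L ⊗[k] L) :=
  Submodule.span k {z | ∃ (a : B) (X Y : L), z = (st.t a * X) ⊗ₜ[k] Y - X ⊗ₜ[k] (st.s a * Y)}

/-- `L ⊗_B L` (the coring tensor square). -/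
abbrev T2 := (L ⊗[k] L) ⧸ st.rel

/-- Class of a pure tensor in `L ⊗_B L`. -/
def mk2 (X Y : L) : st.T2 := Submodule.Quotient.mk (X ⊗ₜ[k] Y)

/-- Evaluate a balanced bilinear expression on an element of `L ⊗_B L`. -/
def lift2 {Q : Type*} [AddCommGroup Q] [Module k Q] (f : L → L → Q) : st.T2 →ₗ[k] Q :=
  qtlift k st.rel f

/-- The relations defining `L ⊗_{B^{op}} L`: `X·t a ⊗ Y ~ X ⊗ t a · Y`. -/
def relOp : Submodule k (L ⊗[k] L) :=
  Submodule.span k {z | ∃ (a : B) (X Y : L), z = (X * st.t a) ⊗ₜ[k] Y - X ⊗ₜ[k] (st.t a * Y)}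

/-- `L ⊗_{B^{op}} L` (domain of the canonical map `λ`). -/
abbrev TOp := (L ⊗[k] L) ⧸ st.relOp

def mkOp (X Y : L) : st.TOp := Submodule.Quotient.mk (X ⊗ₜ[k] Y)

def liftOp {Q : Type*} [AddCommGroup Q] [Module k Q] (f : L → L → Q) : st.TOp →ₗ[k] Q :=
  qtlift k st.relOp f

/-- The relations defining `L ⊗^{B^{op}} L`: `s a · X ⊗ Y ~ X ⊗ Y · s a`. -/
def relA : Submodule k (L ⊗[k] L) :=
  Submodule.span k {z | ∃ (a : B) (X Y : L), z = (st.s a * X) ⊗ₜ[k] Y - X ⊗ₜ[k] (Y * st.s a)}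

/-- `L ⊗^{B^{op}} L` (domain of the canonical map `μ`). -/
abbrev TA := (L ⊗[k] L) ⧸ st.relA

def mkA (X Y : L) : st.TA := Submodule.Quotient.mk (X ⊗ₜ[k] Y)

def liftA {Q : Type*} [AddCommGroup Q] [Module k Q] (f : L → L → Q) : st.TA →ₗ[k] Q :=
  qtlift k st.relA f

/-- Relations for the triple tensor `L ⊗_B L ⊗_B L`. -/
def rel3 : Submodule k (L ⊗[k] (L ⊗[k] L)) :=
  Submodule.span k
    ({z | ∃ (a : B) (X Y Z : L),
        z = (st.t a * X) ⊗ₜ[k] (Y ⊗ₜ[k] Z) - X ⊗ₜ[k] ((st.s a * Y) ⊗ₜ[k] Z)} ∪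
     {z | ∃ (a : B) (X Y Z : L),
        z = X ⊗ₜ[k] ((st.t a * Y) ⊗ₜ[k] Z) - X ⊗ₜ[k] (Y ⊗ₜ[k] (st.s a * Z))})

/-- `L ⊗_B L ⊗_B L`. -/
abbrev T3 := (L ⊗[k] (L ⊗[k] L)) ⧸ st.rel3

def mk3 (X Y Z : L) : st.T3 := Submodule.Quotient.mk (X ⊗ₜ[k] (Y ⊗ₜ[k] Z))

/-- The factorwise product of two elements of `L ⊗_B L`, whenever it is well defined
on representatives (as it is when the left factor lies in the Takeuchi product);
junk value `0` otherwise. -/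
def mulT2 (z w : st.T2) : st.T2 :=
  if h : ∃ u : st.T2, ∀ zr wr : L ⊗[k] L, Submodule.Quotient.mk zr = z →
      Submodule.Quotient.mk wr = w → Submodule.Quotient.mk (zr * wr) = u
  then h.choose else 0

variable (cop : L →ₗ[k] st.T2) (cou : L →ₗ[k] B)

/-- The axioms of a left bialgebroid over `B` with structure `(s,t,Δ,ε) = (st.s, st.t, cop, cou)`
(Definition 2.3 of the paper): `L` is a `B^e`-ring and a `B`-coring, the coproduct corestricts
to an algebra map into the Takeuchi product, and the counit is a left character. -/
structure IsLeftBialgebroid : Prop where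
  comul_one : cop 1 = st.mk2 1 1
  comul_mul : ∀ X Y : L, cop (X * Y) = st.mulT2 (cop X) (cop Y)
  comul_s : ∀ (b : B) (X : L),
    cop (st.s b * X) = st.lift2 (fun x y => st.mk2 (st.s b * x) y) (cop X)
  comul_t : ∀ (b : B) (X : L),
    cop (st.t b * X) = st.lift2 (fun x y => st.mk2 x (st.t b * y)) (cop X)
  takeuchi : ∀ (b : B) (X : L),
    st.lift2 (fun x y => st.mk2 (x * st.t b) y) (cop X) =
      st.lift2 (fun x y => st.mk2 x (y * st.s b)) (cop X)
  coassoc : ∀ X : L,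
    st.lift2 (fun x1 x2 => st.lift2 (fun y1 y2 => st.mk3 x1 y1 y2) (cop x2)) (cop X) =
      st.lift2 (fun x12 x3 => st.lift2 (fun x1 x2 => st.mk3 x1 x2 x3) (cop x12)) (cop X)
  counit_comul_left : ∀ X : L, st.lift2 (fun x1 x2 => st.s (cou x1) * x2) (cop X) = X
  counit_comul_right : ∀ X : L, st.lift2 (fun x1 x2 => st.t (cou x2) * x1) (cop X) = X
  counit_one : cou 1 = 1
  counit_s : ∀ (b : B) (X : L), cou (st.s b * X) = b * cou X
  counit_t : ∀ (b : B) (X : L), cou (st.t b * X) = cou X * b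
  counit_char_s : ∀ X Y : L, cou (X * st.s (cou Y)) = cou (X * Y)
  counit_char_t : ∀ X Y : L, cou (X * st.t (cou Y)) = cou (X * Y)

/-- The canonical map `λ : L ⊗_{B^{op}} L → L ⊗_B L`, `X ⊗ Y ↦ X₍₁₎ ⊗ X₍₂₎Y`. -/
def lam : st.TOp →ₗ[k] st.T2 :=
  st.liftOp (fun X Y => st.lift2 (fun x1 x2 => st.mk2 x1 (x2 * Y)) (cop X))

/-- A left bialgebroid is a left Hopf algebroid if `λ` is bijective. -/
def IsLeftHopf : Prop := Function.Bijective (st.lam cop)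

/-- The canonical map `μ : L ⊗^{B^{op}} L → L ⊗_B L`, `X ⊗ Y ↦ Y₍₁₎X ⊗ Y₍₂₎`. -/
def mu : st.TA →ₗ[k] st.T2 :=
  st.liftA (fun X Y => st.lift2 (fun y1 y2 => st.mk2 (y1 * X) y2) (cop Y))

/-- A left bialgebroid is an anti-left Hopf algebroid if `μ` is bijective. -/
def IsAntiLeftHopf : Prop := Function.Bijective (st.mu cop)

/-- `X₊ ⊗_{B^{op}} X₋ := λ⁻¹(X ⊗_B 1)` (meaningful when `λ` is bijective). -/
def plusMinus (X : L) : st.TOp := Function.invFun (st.lam cop) (st.mk2 X 1)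

/-- `X₍₋₎ ⊗^{B^{op}} X₍₊₎ := μ⁻¹(1 ⊗_B X)` (meaningful when `μ` is bijective). -/
def minusPlus (X : L) : st.TA := Function.invFun (st.mu cop) (st.mk2 1 X)

/-- A left bisection of a left bialgebroid (Definition 3.1). -/
structure IsLeftBisection (σ : L →ₗ[k] B) : Prop where
  unital : σ 1 = 1
  t_prop : ∀ (b : B) (X : L), σ (st.t b * X) = σ X * b
  s_mul : ∀ a b : B, σ (st.s (a * b)) = σ (st.s a) * σ (st.s b)
  s_bij : Function.Bijective (fun b => σ (st.s b))
  prod_t : ∀ X Y : L, σ (X * Y) = σ (X * st.t (σ Y))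
  prod_s : ∀ X Y : L,
    σ (X * Y) = σ (X * st.s (Function.invFun (fun b => σ (st.s b)) (σ Y)))

/-- Convolution of left bisections:  `(σ * η)(X) := σ(s(η(X₍₁₎)) X₍₂₎)`. -/
def bconv (σ η : L →ₗ[k] B) : L →ₗ[k] B :=
  (st.lift2 (fun x1 x2 => σ (st.s (η x1) * x2))).comp cop

/-- A right bisection of a left bialgebroid (Definition 3.6). -/
structure IsRightBisection (σ : L →ₗ[k] B) : Prop where
  unital : σ 1 = 1
  s_prop : ∀ (b : B) (X : L), σ (st.s b * X) = b * σ X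
  t_mul : ∀ a b : B, σ (st.t (a * b)) = σ (st.t b) * σ (st.t a)
  t_bij : Function.Bijective (fun b => σ (st.t b))
  prod_s : ∀ X Y : L, σ (X * Y) = σ (X * st.s (σ Y))
  prod_t : ∀ X Y : L,
    σ (X * Y) = σ (X * st.t (Function.invFun (fun b => σ (st.t b)) (σ Y)))

/-- Convolution of right bisections:  `(σ • η)(X) := σ(t(η(X₍₂₎)) X₍₁₎)`. -/
def rconv (σ η : L →ₗ[k] B) : L →ₗ[k] B :=
  (st.lift2 (fun x1 x2 => σ (st.t (η x2) * x1))).comp cop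

/-- An automorphism `(Φ, φ)` of a left bialgebroid. -/
structure IsBgdAut (Φ : L →ₐ[k] L) (φ : B →ₐ[k] B) : Prop where
  bijL : Function.Bijective Φ
  bijB : Function.Bijective φ
  comp_s : ∀ b : B, Φ (st.s b) = st.s (φ b)
  comp_t : ∀ b : B, Φ (st.t b) = st.t (φ b)
  comp_comul : ∀ X : L,
    cop (Φ X) = st.lift2 (fun x1 x2 => st.mk2 (Φ x1) (Φ x2)) (cop X)
  comp_counit : ∀ X : L, cou (Φ X) = φ (cou X)

/-- `Ad^L_σ(X) := s(σ(X₍₁₎)) X₍₂₎₊ t(σ(X₍₂₎₋))`, for a left Hopf algebroid. -/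
def adL (σ : L →ₗ[k] B) (X : L) : L :=
  st.lift2 (fun x1 x2 => st.s (σ x1) *
    st.liftOp (fun p m => p * st.t (σ m)) (st.plusMinus cop x2)) (cop X)

/-- `Ad^R_σ(X) := t(σ(X₍₂₎)) X₍₁₎₍₊₎ s(σ(X₍₁₎₍₋₎))`, for an anti-left Hopf algebroid. -/
def adR (σ : L →ₗ[k] B) (X : L) : L :=
  st.lift2 (fun x1 x2 => st.t (σ x2) *
    st.liftA (fun m p => p * st.s (σ m)) (st.minusPlus cop x1)) (cop X)

/-- The `B`-bimodule-map conditions on a map `L → B` used for `C¹(L,B)`. -/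
def IsBimodMap (U : L →ₗ[k] B) : Prop :=
  (∀ (b : B) (X : L), U (st.t b * X) = U X * b) ∧
  (∀ (b : B) (X : L), U (st.s b * X) = b * U X)

/-- Convolution `(U * V)(X) = U(X₍₁₎) V(X₍₂₎)` of `B`-valued maps. -/
def cconv (U V : L →ₗ[k] B) : L →ₗ[k] B :=
  (st.lift2 (fun x1 x2 => U x1 * V x2)).comp cop

/-- Extended vertical bisections `C¹(L,B)`: unital convolution-invertible `B`-bimodule maps
`U : L → B` with `U(X s(b)) = U(X t(b))`. -/
def IsC1 (U : L →ₗ[k] B) : Prop :=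
  U 1 = 1 ∧ st.IsBimodMap U ∧
  (∀ (b : B) (X : L), U (X * st.s b) = U (X * st.t b)) ∧
  ∃ V : L →ₗ[k] B, st.IsBimodMap V ∧ st.cconv cop U V = cou ∧ st.cconv cop V U = cou

/-- Convolution product on `B`-bimodule maps `L ⊗_{B^e} L → B`:
`(f ⋆ g)(X,Y) = f(X₍₁₎,Y₍₁₎) g(X₍₂₎,Y₍₂₎)`. -/
def conv2 (f g : L → L → B) (X Y : L) : B :=
  st.lift2 (fun y1 y2 =>
    st.lift2 (fun x1 x2 => f x1 y1 * g x2 y2) (cop X)) (cop Y)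

/-- The unit `ε̃(X ⊗ Y) = ε(XY)` of the convolution algebra. -/
def unit2 (X Y : L) : B := cou (X * Y)

/-- Left-hand side of the 2-cocycle condition: `Γ(X, s(Γ(Y₍₁₎,Z₍₁₎)) Y₍₂₎Z₍₂₎)`. -/
def cocL (Γ : L → L → B) (X Y Z : L) : B :=
  st.lift2 (fun z1 z2 =>
    st.lift2 (fun y1 y2 => Γ X (st.s (Γ y1 z1) * (y2 * z2))) (cop Y)) (cop Z)

/-- Right-hand side of the 2-cocycle condition: `Γ(s(Γ(X₍₁₎,Y₍₁₎)) X₍₂₎Y₍₂₎, Z)`. -/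
def cocR (Γ : L → L → B) (X Y Z : L) : B :=
  st.lift2 (fun y1 y2 =>
    st.lift2 (fun x1 x2 => Γ (st.s (Γ x1 y1) * (x2 * y2)) Z) (cop X)) (cop Y)

/-- Membership of a bilinear map in `_B Hom_B (L ⊗_{B^e} L, B)`. -/
def IsBihom (Γ : L → L → B) : Prop :=
  (∃ Γ' : L →ₗ[k] L →ₗ[k] B, ∀ X Y, Γ' X Y = Γ X Y) ∧
  (∀ (b c : B) (X Y : L), Γ (st.s b * (st.t c * X)) Y = b * Γ X Y * c) ∧
  (∀ (b c : B) (X Y : L), Γ (X * st.s b * st.t c) Y = Γ X (st.s b * (st.t c * Y)))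

/-- An invertible normalised 2-cocycle on a left bialgebroid (Definition 2.6);
the collection of these is `Z²(L,B)`. -/
structure IsZ2 (Γ : L → L → B) : Prop where
  bihom : st.IsBihom Γ
  norm_left : ∀ X : L, Γ 1 X = cou X
  norm_right : ∀ X : L, Γ X 1 = cou X
  st_indep : ∀ (b : B) (X Y : L), Γ X (Y * st.s b) = Γ X (Y * st.t b)
  cocycle : ∀ X Y Z : L, st.cocL cop Γ X Y Z = st.cocR cop Γ X Y Z
  inv : ∃ Γi : L → L → B, st.IsBihom Γi ∧
    (∀ X Y, st.conv2 cop Γ Γi X Y = unit2 cou X Y) ∧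
    (∀ X Y, st.conv2 cop Γi Γ X Y = unit2 cou X Y)

/-- The coboundary `∂U(X,Y) = U⁻¹(X₍₁₎ t(U⁻¹(Y₍₁₎))) U(X₍₂₎Y₍₂₎)` of `U ∈ C¹(L,B)`. -/
def coboundary (U Ui : L →ₗ[k] B) (X Y : L) : B :=
  st.lift2 (fun y1 y2 =>
    st.lift2 (fun x1 x2 => Ui (x1 * st.t (Ui y1)) * U (x2 * y2)) (cop X)) (cop Y)

/-- The transform `Γ^U(X,Y) = U⁻¹(X₍₁₎ t(U⁻¹(Y₍₁₎))) Γ(X₍₂₎,Y₍₂₎) U(X₍₃₎Y₍₃₎)`. -/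
def gammaU (Γ : L → L → B) (U Ui : L →ₗ[k] B) (X Y : L) : B :=
  st.lift2 (fun y1 y23 => st.lift2 (fun y2 y3 =>
    st.lift2 (fun x1 x23 => st.lift2 (fun x2 x3 =>
      Ui (x1 * st.t (Ui y1)) * Γ x2 y2 * U (x3 * y3)) (cop x23)) (cop X))
    (cop y23)) (cop Y)

/-- The cotwisted product `X ·_Γ Y := s(Γ(X₍₁₎,Y₍₁₎)) t(Γ⁻¹(X₍₃₎,Y₍₃₎)) X₍₂₎Y₍₂₎`. -/
def prodG (Γ Γi : L → L → B) (X Y : L) : L :=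
  st.lift2 (fun y1 y23 => st.lift2 (fun y2 y3 =>
    st.lift2 (fun x1 x23 => st.lift2 (fun x2 x3 =>
      st.s (Γ x1 y1) * (st.t (Γi x3 y3) * (x2 * y2))) (cop x23)) (cop X))
    (cop y23)) (cop Y)

/-- `Ad_U(X) := s(U(X₍₁₎)) t(U⁻¹(X₍₃₎)) X₍₂₎`. -/
def adU (U Ui : L →ₗ[k] B) (X : L) : L :=
  st.lift2 (fun x1 x23 => st.lift2 (fun x2 x3 =>
    st.s (U x1) * (st.t (Ui x3) * x2)) (cop x23)) (cop X)

end BgdST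

end

namespace BgdST

variable {k : Type*} [Field k] {B L : Type*} [Ring B] [Algebra k B] [Ring L] [Algebra k L]
variable {st : BgdST k B L}
variable {Q P : Type*} [AddCommGroup Q] [Module k Q] [AddCommGroup P] [Module k P]

/-- The map `qtlift` agrees with a bilinear function killing the relations on pure tensors. -/
theorem qtlift_mk {p : Submodule k (L ⊗[k] L)} (f : L →ₗ[k] L →ₗ[k] Q)
    (hp : p ≤ LinearMap.ker (TensorProduct.lift f)) (x y : L) :
    qtlift k p (fun x y => f x y) (Submodule.Quotient.mk (x ⊗ₜ[k] y)) = f x y := by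
  have h : ∃ F : ((L ⊗[k] L) ⧸ p) →ₗ[k] Q,
      ∀ x y, F (Submodule.Quotient.mk (x ⊗ₜ[k] y)) = f x y :=
    ⟨p.liftQ (TensorProduct.lift f) hp, fun x y => by
      rw [Submodule.liftQ_apply, TensorProduct.lift.tmul]⟩
  unfold qtlift
  rw [dif_pos h]
  exact h.choose_spec x y

/-- Two linear maps on a quotient of `L ⊗ L` agreeing on pure tensors are equal. -/
theorem quot_ext {p : Submodule k (L ⊗[k] L)} {F F' : ((L ⊗[k] L) ⧸ p) →ₗ[k] Q}
    (h : ∀ x y, F (Submodule.Quotient.mk (x ⊗ₜ[k] y)) = F' (Submodule.Quotient.mk (x ⊗ₜ[k] y))) :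
    F = F' :=
  Submodule.linearMap_qext _ (TensorProduct.ext' h)

/-- Bilinear functions on `L × L`. -/
structure Bilin (f : L → L → Q) : Prop where
  add_left : ∀ x x' y, f (x + x') y = f x y + f x' y
  add_right : ∀ x y y', f x (y + y') = f x y + f x y'
  smul_left : ∀ (c : k) x y, f (c • x) y = c • f x y
  smul_right : ∀ (c : k) x y, f x (c • y) = c • f x y

/-- The bilinear map attached to a bilinear function. -/
def Bilin.toLin {f : L → L → Q} (hf : Bilin (k := k) f) : L →ₗ[k] L →ₗ[k] Q :=
  LinearMap.mk₂ k f hf.add_left hf.smul_left hf.add_right hf.smul_right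

/-- Functions on `L × L` inducing a linear map on `L ⊗_B L`. -/
structure Bal2 (st : BgdST k B L) (f : L → L → Q) : Prop extends Bilin (k := k) f where
  bal : ∀ (a : B) x y, f (st.t a * x) y = f x (st.s a * y)

/-- Functions on `L × L` inducing a linear map on `L ⊗_{B^{op}} L`. -/
structure BalOp (st : BgdST k B L) (f : L → L → Q) : Prop extends Bilin (k := k) f where
  bal : ∀ (a : B) x y, f (x * st.t a) y = f x (st.t a * y)

theorem lift2_mk2 {f : L → L → Q} (hf : Bal2 st f) (x y : L) :
    st.lift2 f (st.mk2 x y) = f x y := by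
  refine qtlift_mk hf.toLin (Submodule.span_le.2 ?_) x y
  rintro _ ⟨a, x, y, rfl⟩
  simp [Bilin.toLin, hf.bal]

theorem liftOp_mkOp {f : L → L → Q} (hf : BalOp st f) (x y : L) :
    st.liftOp f (st.mkOp x y) = f x y := by
  refine qtlift_mk hf.toLin (Submodule.span_le.2 ?_) x y
  rintro _ ⟨a, x, y, rfl⟩
  simp [Bilin.toLin, hf.bal]

theorem T2_ext {F F' : st.T2 →ₗ[k] Q} (h : ∀ x y, F (st.mk2 x y) = F' (st.mk2 x y)) : F = F' :=
  quot_ext h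

theorem TOp_ext {F F' : st.TOp →ₗ[k] Q} (h : ∀ x y, F (st.mkOp x y) = F' (st.mkOp x y)) :
    F = F' :=
  quot_ext h

theorem map_lift2 {f : L → L → Q} (hf : Bal2 st f) (T : Q →ₗ[k] P) (z : st.T2) :
    T (st.lift2 f z) = st.lift2 (fun x y => T (f x y)) z := by
  have hTf : Bal2 st fun x y => T (f x y) :=
    { add_left := fun x x' y => by rw [hf.add_left, map_add]
      add_right := fun x y y' => by rw [hf.add_right, map_add]
      smul_left := fun c x y => by rw [hf.smul_left, map_smul]
      smul_right := fun c x y => by rw [hf.smul_right, map_smul]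
      bal := fun a x y => by rw [hf.bal] }
  exact LinearMap.congr_fun (T2_ext (F := T ∘ₗ st.lift2 f)
    (F' := st.lift2 fun x y => T (f x y)) fun x y => by
      rw [LinearMap.comp_apply, lift2_mk2 hf, lift2_mk2 hTf]) z

theorem Bal2.add {f g : L → L → Q} (hf : Bal2 st f) (hg : Bal2 st g) :
    Bal2 st fun x y => f x y + g x y where
  add_left x x' y := by rw [hf.add_left, hg.add_left]; abel
  add_right x y y' := by rw [hf.add_right, hg.add_right]; abel
  smul_left c x y := by rw [hf.smul_left, hg.smul_left, smul_add]
  smul_right c x y := by rw [hf.smul_right, hg.smul_right, smul_add]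
  bal a x y := by rw [hf.bal, hg.bal]

theorem lift2_add {f g : L → L → Q} (hf : Bal2 st f) (hg : Bal2 st g) (z : st.T2) :
    st.lift2 (fun x y => f x y + g x y) z = st.lift2 f z + st.lift2 g z :=
  LinearMap.congr_fun (T2_ext (F := st.lift2 fun x y => f x y + g x y)
    (F' := st.lift2 f + st.lift2 g) fun x y => by
      rw [LinearMap.add_apply, lift2_mk2 (hf.add hg), lift2_mk2 hf, lift2_mk2 hg]) z

theorem lift2_smul {f : L → L → Q} (hf : Bal2 st f) (c : k) (z : st.T2) :
    st.lift2 (fun x y => c • f x y) z = c • st.lift2 f z :=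
  (map_lift2 hf (c • (LinearMap.id : Q →ₗ[k] Q)) z).symm

theorem mk2_bilin : Bilin (k := k) st.mk2 where
  add_left x x' y := by simp [mk2, TensorProduct.add_tmul]
  add_right x y y' := by simp [mk2, TensorProduct.tmul_add]
  smul_left c x y := by simp [mk2, ← TensorProduct.smul_tmul']
  smul_right c x y := by simp [mk2]

theorem mk2_bal (a : B) (x y : L) : st.mk2 (st.t a * x) y = st.mk2 x (st.s a * y) :=
  (Submodule.Quotient.eq _).2 (Submodule.subset_span ⟨a, x, y, rfl⟩)

/-- Linear maps `u`, `v` on `L`, `φ`-linear over `t` and `s`, induce `u ⊗ v` on `L ⊗_B L`. -/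
theorem bal2_mk2_map {u v : L →ₗ[k] L} (φ : B → B) (hu : ∀ a x, u (st.t a * x) = st.t (φ a) * u x)
    (hv : ∀ a x, v (st.s a * x) = st.s (φ a) * v x) :
    Bal2 st fun x y => st.mk2 (u x) (v y) where
  add_left x x' y := by rw [map_add, mk2_bilin.add_left]
  add_right x y y' := by rw [map_add, mk2_bilin.add_right]
  smul_left c x y := by rw [map_smul, mk2_bilin.smul_left]
  smul_right c x y := by rw [map_smul, mk2_bilin.smul_right]
  bal a x y := by rw [hu, hv, mk2_bal]

theorem bal2_mk2 : Bal2 st st.mk2 :=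
  bal2_mk2_map (u := LinearMap.id) (v := LinearMap.id) id (fun _ _ => rfl) fun _ _ => rfl

theorem bal2_s_mul (b : B) : Bal2 st fun x y => st.mk2 (st.s b * x) y :=
  bal2_mk2_map (u := LinearMap.mulLeft k (st.s b)) (v := LinearMap.id) id
    (fun a x => by simp only [LinearMap.mulLeft_apply, ← mul_assoc, st.st_comm, id])
    fun _ _ => rfl

theorem bal2_t_mul (b : B) : Bal2 st fun x y => st.mk2 x (st.t b * y) :=
  bal2_mk2_map (u := LinearMap.id) (v := LinearMap.mulLeft k (st.t b)) id (fun _ _ => rfl)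
    fun a x => by simp only [LinearMap.mulLeft_apply, ← mul_assoc, st.st_comm, id]

/-- Functions on `L × L × L` inducing a linear map on `L ⊗_B L ⊗_B L`. -/
structure Bal3 (st : BgdST k B L) (f : L → L → L → Q) : Prop where
  add₁ : ∀ x x' y z, f (x + x') y z = f x y z + f x' y z
  smul₁ : ∀ (c : k) x y z, f (c • x) y z = c • f x y z
  right : ∀ x, Bal2 st (f x)
  left : ∀ z, Bal2 st fun x y => f x y z

theorem mk3_bal3 : Bal3 st st.mk3 where
  add₁ x x' y z := by simp [mk3, TensorProduct.add_tmul]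
  smul₁ c x y z := by simp [mk3, ← TensorProduct.smul_tmul']
  right x :=
    { add_left := fun x x' y => by simp [mk3, TensorProduct.tmul_add, TensorProduct.add_tmul]
      add_right := fun x y y' => by simp [mk3, TensorProduct.tmul_add]
      smul_left := fun c x y => by simp [mk3, ← TensorProduct.smul_tmul']
      smul_right := fun c x y => by simp [mk3]
      bal := fun a y z => (Submodule.Quotient.eq _).2
        (Submodule.subset_span (Or.inr ⟨a, x, y, z, rfl⟩)) }
  left z :=
    { add_left := fun x x' y => by simp [mk3, TensorProduct.add_tmul]
      add_right := fun x y y' => by simp [mk3, TensorProduct.tmul_add, TensorProduct.add_tmul]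
      smul_left := fun c x y => by simp [mk3, ← TensorProduct.smul_tmul']
      smul_right := fun c x y => by simp [mk3, ← TensorProduct.smul_tmul']
      bal := fun a x y => (Submodule.Quotient.eq _).2
        (Submodule.subset_span (Or.inl ⟨a, x, y, z, rfl⟩)) }

theorem Bal3.exists_lift {f : L → L → L → Q} (hf : Bal3 st f) :
    ∃ F : st.T3 →ₗ[k] Q, ∀ x y z, F (st.mk3 x y z) = f x y z := by
  let g : L →ₗ[k] (L ⊗[k] L) →ₗ[k] Q :=
    { toFun := fun x => TensorProduct.lift (hf.right x).toLin
      map_add' := fun x x' => TensorProduct.ext' fun y z => by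
        simp [Bilin.toLin, hf.add₁]
      map_smul' := fun c x => TensorProduct.ext' fun y z => by
        simp [Bilin.toLin, hf.smul₁] }
  have hg : ∀ x y z, TensorProduct.lift g (x ⊗ₜ[k] (y ⊗ₜ[k] z)) = f x y z := fun x y z => by
    simp [g, Bilin.toLin]
  refine ⟨st.rel3.liftQ (TensorProduct.lift g) (Submodule.span_le.2 ?_), fun x y z => ?_⟩
  · rintro _ (⟨a, x, y, z, rfl⟩ | ⟨a, x, y, z, rfl⟩)
    · simp only [SetLike.mem_coe, LinearMap.mem_ker, map_sub, hg]
      exact sub_eq_zero.2 ((hf.left z).bal a x y)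
    · simp only [SetLike.mem_coe, LinearMap.mem_ker, map_sub, hg]
      exact sub_eq_zero.2 ((hf.right x).bal a y z)
  · exact (Submodule.liftQ_apply _ _ _).trans (hg x y z)

variable {cop : L →ₗ[k] st.T2} {cou : L →ₗ[k] B}

/-- The function `x ⊗ y ↦ f x y₍₁₎ y₍₂₎` is balanced. -/
theorem Bal3.bal2_right (hbgd : st.IsLeftBialgebroid cop cou) {f : L → L → L → Q}
    (hf : Bal3 st f) : Bal2 st fun x y => st.lift2 (fun y1 y2 => f x y1 y2) (cop y) where
  add_left x x' y := by
    rw [← lift2_add (hf.right x) (hf.right x')]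
    simp only [hf.add₁]
  add_right x y y' := by rw [map_add, map_add]
  smul_left c x y := by
    rw [← lift2_smul (hf.right x)]
    simp only [hf.smul₁]
  smul_right c x y := by rw [map_smul, map_smul]
  bal a x y := by
    rw [hbgd.comul_s, map_lift2 (bal2_s_mul a)]
    simp only [lift2_mk2 (hf.right x), (hf.left _).bal]

theorem Bal3.bal2_left (hbgd : st.IsLeftBialgebroid cop cou) {f : L → L → L → Q}
    (hf : Bal3 st f) : Bal2 st fun x z => st.lift2 (fun x1 x2 => f x1 x2 z) (cop x) where
  add_left x x' y := by rw [map_add, map_add]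
  add_right x y y' := by
    rw [← lift2_add (hf.left y) (hf.left y')]
    simp only [(hf.right _).add_right]
  smul_left c x y := by rw [map_smul, map_smul]
  smul_right c x y := by
    rw [← lift2_smul (hf.left y)]
    simp only [(hf.right _).smul_right]
  bal a x y := by
    rw [hbgd.comul_t, map_lift2 (bal2_t_mul a)]
    simp only [lift2_mk2 (hf.left y), (hf.right _).bal]

/-- Coassociativity evaluated on a balanced trilinear function. -/
theorem lift2_coassoc (hbgd : st.IsLeftBialgebroid cop cou) {f : L → L → L → Q}
    (hf : Bal3 st f) (X : L) :
    st.lift2 (fun x1 x2 => st.lift2 (fun y1 y2 => f x1 y1 y2) (cop x2)) (cop X) =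
      st.lift2 (fun x12 x3 => st.lift2 (fun x1 x2 => f x1 x2 x3) (cop x12)) (cop X) := by
  obtain ⟨F, hF⟩ := hf.exists_lift
  have h := congrArg F (hbgd.coassoc X)
  rw [map_lift2 (mk3_bal3.bal2_right hbgd), map_lift2 (mk3_bal3.bal2_left hbgd)] at h
  simpa only [map_lift2 (mk3_bal3.right _), map_lift2 (mk3_bal3.left _), hF] using h

theorem comul_s_one (hbgd : st.IsLeftBialgebroid cop cou) (b : B) :
    cop (st.s b) = st.mk2 (st.s b) 1 := by
  have h := hbgd.comul_s b 1
  rwa [hbgd.comul_one, mul_one, lift2_mk2 (bal2_s_mul b), mul_one] at h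

theorem comul_t_one (hbgd : st.IsLeftBialgebroid cop cou) (b : B) :
    cop (st.t b) = st.mk2 1 (st.t b) := by
  have h := hbgd.comul_t b 1
  rwa [hbgd.comul_one, mul_one, lift2_mk2 (bal2_t_mul b), mul_one] at h

theorem bal2_mul (y y' : L) : Bal2 st fun x x' => st.mk2 (x * y) (x' * y') :=
  bal2_mk2_map (u := LinearMap.mulRight k y) (v := LinearMap.mulRight k y') id
    (fun _ _ => mul_assoc _ _ _) fun _ _ => mul_assoc _ _ _

/-- The diagonal action of `p` on `L ⊗_B L` is well defined by the Takeuchi condition. -/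
theorem bal2_diag (hbgd : st.IsLeftBialgebroid cop cou) (p : L) :
    Bal2 st fun y1 y2 => st.lift2 (fun x1 x2 => st.mk2 (x1 * y1) (x2 * y2)) (cop p) where
  add_left x x' y := by
    rw [← lift2_add (bal2_mul x y) (bal2_mul x' y)]
    simp only [mul_add, mk2_bilin.add_left]
  add_right x y y' := by
    rw [← lift2_add (bal2_mul x y) (bal2_mul x y')]
    simp only [mul_add, mk2_bilin.add_right]
  smul_left c x y := by
    rw [← lift2_smul (bal2_mul x y)]
    simp only [mul_smul_comm, mk2_bilin.smul_left]
  smul_right c x y := by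
    rw [← lift2_smul (bal2_mul x y)]
    simp only [mul_smul_comm, mk2_bilin.smul_right]
  bal a x y := by
    have ht : Bal2 st fun x y => st.mk2 (x * st.t a) y := by
      simpa using bal2_mul (st := st) (st.t a) 1
    have hs : Bal2 st fun x y => st.mk2 x (y * st.s a) := by
      simpa using bal2_mul (st := st) 1 (st.s a)
    have h := congrArg (st.lift2 fun u v => st.mk2 (u * x) (v * y)) (hbgd.takeuchi a p)
    rw [map_lift2 ht, map_lift2 hs] at h
    simpa only [lift2_mk2 (bal2_mul _ _), mul_assoc] using h

/-- The diagonal action of `L` on `L ⊗_B L`. -/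
noncomputable def diag (st : BgdST k B L) (cop : L →ₗ[k] st.T2) (p : L) : st.T2 →ₗ[k] st.T2 :=
  st.lift2 fun y1 y2 => st.lift2 (fun x1 x2 => st.mk2 (x1 * y1) (x2 * y2)) (cop p)

theorem comul_mul_eq_diag (hbgd : st.IsLeftBialgebroid cop cou) (X Y : L) :
    cop (X * Y) = diag st cop X (cop Y) := by
  have key : ∀ zr wr : L ⊗[k] L, Submodule.Quotient.mk zr = cop X →
      (Submodule.Quotient.mk (zr * wr) : st.T2) = diag st cop X (Submodule.Quotient.mk wr) := by
    intro zr wr hz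
    induction wr with
    | zero => simp
    | add a b ha hb => rw [mul_add, Submodule.Quotient.mk_add, ha, hb, Submodule.Quotient.mk_add,
        map_add]
    | tmul y1 y2 =>
      refine Eq.trans ?_ (lift2_mk2 (bal2_diag hbgd X) y1 y2).symm
      rw [← hz]
      clear hz
      induction zr with
      | zero => simp
      | add a b ha hb => rw [add_mul, Submodule.Quotient.mk_add, ha, hb, Submodule.Quotient.mk_add,
          map_add]
      | tmul x1 x2 =>
        rw [Algebra.TensorProduct.tmul_mul_tmul]
        exact (lift2_mk2 (bal2_mul y1 y2) x1 x2).symm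
  have h : ∃ u : st.T2, ∀ zr wr : L ⊗[k] L, Submodule.Quotient.mk zr = cop X →
      Submodule.Quotient.mk wr = cop Y → Submodule.Quotient.mk (zr * wr) = u :=
    ⟨diag st cop X (cop Y), fun zr wr hz hw => by rw [key zr wr hz, hw]⟩
  rw [hbgd.comul_mul, mulT2, dif_pos h]
  obtain ⟨zr, hz⟩ := Submodule.Quotient.mk_surjective _ (cop X)
  obtain ⟨wr, hw⟩ := Submodule.Quotient.mk_surjective _ (cop Y)
  rw [← h.choose_spec zr wr hz hw, key zr wr hz, hw]

/-! ### The diagonal action and the canonical map -/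

/-- Right multiplication by `u ⊗ v` on `L ⊗_B L`. -/
noncomputable def rmul (st : BgdST k B L) (u v : L) : st.T2 →ₗ[k] st.T2 :=
  st.lift2 fun x y => st.mk2 (x * u) (y * v)

theorem rmul_mk2 (u v x y : L) : rmul st u v (st.mk2 x y) = st.mk2 (x * u) (y * v) :=
  lift2_mk2 (bal2_mul u v) x y

theorem diag_mk2 (hbgd : st.IsLeftBialgebroid cop cou) (p u v : L) :
    diag st cop p (st.mk2 u v) = rmul st u v (cop p) :=
  lift2_mk2 (bal2_diag hbgd p) u v

theorem rmul_rmul (u v u' v' : L) (z : st.T2) :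
    rmul st u' v' (rmul st u v z) = rmul st (u * u') (v * v') z :=
  LinearMap.congr_fun (T2_ext (F := rmul st u' v' ∘ₗ rmul st u v) (F' := rmul st (u * u') (v * v'))
    fun x y => by
      rw [LinearMap.comp_apply, rmul_mk2, rmul_mk2, rmul_mk2, mul_assoc, mul_assoc]) z

theorem rmul_diag (hbgd : st.IsLeftBialgebroid cop cou) (p u v : L) (z : st.T2) :
    rmul st u v (diag st cop p z) = diag st cop p (rmul st u v z) :=
  LinearMap.congr_fun (T2_ext (F := rmul st u v ∘ₗ diag st cop p)
    (F' := diag st cop p ∘ₗ rmul st u v) fun x y => by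
      rw [LinearMap.comp_apply, LinearMap.comp_apply, diag_mk2 hbgd, rmul_rmul, rmul_mk2,
        diag_mk2 hbgd]) z

theorem diag_mul (hbgd : st.IsLeftBialgebroid cop cou) (p q : L) (z : st.T2) :
    diag st cop (p * q) z = diag st cop p (diag st cop q z) :=
  LinearMap.congr_fun (T2_ext (F := diag st cop (p * q)) (F' := diag st cop p ∘ₗ diag st cop q)
    fun x y => by
      rw [LinearMap.comp_apply, diag_mk2 hbgd, diag_mk2 hbgd, comul_mul_eq_diag hbgd,
        rmul_diag hbgd]) z

theorem diag_t (hbgd : st.IsLeftBialgebroid cop cou) (a : B) (x y : L) :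
    diag st cop (st.t a) (st.mk2 x y) = st.mk2 x (st.t a * y) := by
  rw [diag_mk2 hbgd, comul_t_one hbgd, rmul_mk2, one_mul]

theorem diag_s (hbgd : st.IsLeftBialgebroid cop cou) (a : B) (x y : L) :
    diag st cop (st.s a) (st.mk2 x y) = st.mk2 (st.s a * x) y := by
  rw [diag_mk2 hbgd, comul_s_one hbgd, rmul_mk2, one_mul]

theorem rmul_one_apply (m : L) (z : st.T2) :
    rmul st 1 m z = st.lift2 (fun x y => st.mk2 x (y * m)) z := by
  simp only [rmul, mul_one]

theorem rmul_one_one (z : st.T2) : rmul st 1 1 z = z :=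
  LinearMap.congr_fun (T2_ext (F := rmul st 1 1) (F' := LinearMap.id) fun x y => by
    rw [rmul_mk2, mul_one, mul_one, LinearMap.id_apply]) z

theorem lam_mkOp (hbgd : st.IsLeftBialgebroid cop cou) (p m : L) :
    st.lam cop (st.mkOp p m) = diag st cop p (st.mk2 1 m) := by
  have hlam : BalOp st fun X Y => st.lift2 (fun x1 x2 => st.mk2 x1 (x2 * Y)) (cop X) := by
    have hfun : (fun X Y => st.lift2 (fun x1 x2 => st.mk2 x1 (x2 * Y)) (cop X)) =
        fun X Y => rmul st 1 Y (cop X) := by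
      funext X Y
      rw [rmul_one_apply]
    rw [hfun]
    exact
      { add_left := fun x x' y => by rw [map_add, map_add]
        add_right := fun x y y' => by
          rw [← diag_mk2 hbgd, mk2_bilin.add_right, map_add, diag_mk2 hbgd, diag_mk2 hbgd]
        smul_left := fun c x y => by rw [map_smul, map_smul]
        smul_right := fun c x y => by
          rw [← diag_mk2 hbgd, mk2_bilin.smul_right, map_smul, diag_mk2 hbgd]
        bal := fun a x y => by
          rw [← diag_mk2 hbgd, diag_mul hbgd, diag_t hbgd, diag_mk2 hbgd] }
  rw [lam, liftOp_mkOp hlam, diag_mk2 hbgd, rmul_one_apply]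

/-- Linear maps on `L ⊗_B L` agreeing on the image of the canonical map are equal. -/
theorem T2_ext_of_isLeftHopf (hbgd : st.IsLeftBialgebroid cop cou) (hHopf : st.IsLeftHopf cop)
    {F F' : st.T2 →ₗ[k] Q}
    (h : ∀ p m, F (diag st cop p (st.mk2 1 m)) = F' (diag st cop p (st.mk2 1 m))) : F = F' := by
  have hlam : F ∘ₗ st.lam cop = F' ∘ₗ st.lam cop := TOp_ext fun p m => by
    rw [LinearMap.comp_apply, LinearMap.comp_apply, lam_mkOp hbgd, h]
  refine LinearMap.ext fun z => ?_
  obtain ⟨Z, rfl⟩ := hHopf.2 z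
  exact LinearMap.congr_fun hlam Z

/-! ### Left and right translations -/

/-- Algebra maps `L → L` which are `B`-linear for the target, `φ`-linear for the source, and
colinear for the right coaction of `L` on itself. -/
structure IsLTrans (st : BgdST k B L) (cop : L →ₗ[k] st.T2) (G : L →ₐ[k] L) (φ : B ≃ₐ[k] B) :
    Prop where
  map_s : ∀ b, G (st.s b) = st.s (φ b)
  map_t : ∀ b, G (st.t b) = st.t b
  map_comul : ∀ X, cop (G X) = st.lift2 (fun x y => st.mk2 (G x) y) (cop X)

/-- Algebra maps `L → L` which are `B`-linear for the source, `φ`-linear for the target, and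
colinear for the left coaction of `L` on itself. -/
structure IsRTrans (st : BgdST k B L) (cop : L →ₗ[k] st.T2) (F : L →ₐ[k] L) (φ : B ≃ₐ[k] B) :
    Prop where
  map_s : ∀ b, F (st.s b) = st.s b
  map_t : ∀ b, F (st.t b) = st.t (φ b)
  map_comul : ∀ X, cop (F X) = st.lift2 (fun x y => st.mk2 x (F y)) (cop X)

theorem bal2_s_left {σ : L →ₗ[k] B} (hσ : ∀ b X, σ (st.t b * X) = σ X * b) {v : L →ₗ[k] L}
    (hv : ∀ a x, v (st.s a * x) = st.s a * v x) : Bal2 st fun x y => st.s (σ x) * v y where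
  add_left x x' y := by rw [map_add, map_add, add_mul]
  add_right x y y' := by rw [map_add, mul_add]
  smul_left c x y := by rw [map_smul, map_smul, smul_mul_assoc]
  smul_right c x y := by rw [map_smul, mul_smul_comm]
  bal a x y := by rw [hσ, hv, map_mul, mul_assoc]

theorem bal2_t_right {ρ : L →ₗ[k] B} {φ : B → B} (hρ : ∀ a X, ρ (st.s a * X) = φ a * ρ X)
    {u : L →ₗ[k] L} (hu : ∀ a x, u (st.t a * x) = st.t (φ a) * u x) :
    Bal2 st fun x y => st.t (ρ y) * u x where
  add_left x x' y := by rw [map_add, mul_add]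
  add_right x y y' := by rw [map_add, map_add, add_mul]
  smul_left c x y := by rw [map_smul, mul_smul_comm]
  smul_right c x y := by rw [map_smul, map_smul, smul_mul_assoc]
  bal a x y := by rw [hρ, hu, st.t_mul, mul_assoc]

theorem bal2_s (σ : L →ₗ[k] B) (hσ : ∀ b X, σ (st.t b * X) = σ X * b) :
    Bal2 st fun x y => st.s (σ x) * y :=
  bal2_s_left (v := LinearMap.id) hσ fun _ _ => rfl

theorem bal2_cou_s (hbgd : st.IsLeftBialgebroid cop cou) :
    Bal2 st fun x y => st.s (cou x) * y :=
  bal2_s cou hbgd.counit_t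

theorem bal2_cou_t (hbgd : st.IsLeftBialgebroid cop cou) :
    Bal2 st fun x y => st.t (cou y) * x :=
  bal2_t_right (φ := id) (u := LinearMap.id) hbgd.counit_s fun _ _ => rfl

theorem IsLTrans.bal2 {G : L →ₐ[k] L} {φ : B ≃ₐ[k] B} (hG : IsLTrans st cop G φ) :
    Bal2 st fun x y => st.mk2 (G x) y :=
  bal2_mk2_map (u := G.toLinearMap) (v := LinearMap.id) id
    (fun a x => by rw [AlgHom.toLinearMap_apply, map_mul, hG.map_t]; rfl) fun _ _ => rfl

theorem IsRTrans.bal2 {F : L →ₐ[k] L} {φ : B ≃ₐ[k] B} (hF : IsRTrans st cop F φ) :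
    Bal2 st fun x y => st.mk2 x (F y) :=
  bal2_mk2_map (u := LinearMap.id) (v := F.toLinearMap) id (fun _ _ => rfl)
    fun a x => by rw [AlgHom.toLinearMap_apply, map_mul, hF.map_s]; rfl

theorem IsLTrans.eq_lift2 (hbgd : st.IsLeftBialgebroid cop cou) {G : L →ₐ[k] L} {φ : B ≃ₐ[k] B}
    (hG : IsLTrans st cop G φ) (X : L) :
    G X = st.lift2 (fun x y => st.s (cou (G x)) * y) (cop X) := by
  rw [← hbgd.counit_comul_left (G X), hG.map_comul, map_lift2 hG.bal2]
  simp only [lift2_mk2 (bal2_cou_s hbgd)]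

theorem IsRTrans.eq_lift2 (hbgd : st.IsLeftBialgebroid cop cou) {F : L →ₐ[k] L} {φ : B ≃ₐ[k] B}
    (hF : IsRTrans st cop F φ) (X : L) :
    F X = st.lift2 (fun x y => st.t (cou (F y)) * x) (cop X) := by
  rw [← hbgd.counit_comul_right (F X), hF.map_comul, map_lift2 hF.bal2]
  simp only [lift2_mk2 (bal2_cou_t hbgd)]

theorem IsLTrans.counit_t (hbgd : st.IsLeftBialgebroid cop cou) {G : L →ₐ[k] L} {φ : B ≃ₐ[k] B}
    (hG : IsLTrans st cop G φ) (b : B) (X : L) : cou (G (st.t b * X)) = cou (G X) * b := by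
  rw [map_mul, hG.map_t, hbgd.counit_t]

theorem IsLTrans.comp {G G' : L →ₐ[k] L} {φ φ' : B ≃ₐ[k] B} (hG : IsLTrans st cop G φ)
    (hG' : IsLTrans st cop G' φ') : IsLTrans st cop (G.comp G') (φ'.trans φ) where
  map_s b := by simp [hG'.map_s, hG.map_s]
  map_t b := by simp [hG'.map_t, hG.map_t]
  map_comul X := by
    rw [AlgHom.comp_apply, hG.map_comul, hG'.map_comul, map_lift2 hG'.bal2]
    simp only [lift2_mk2 hG.bal2, AlgHom.comp_apply]

theorem IsRTrans.comp {F F' : L →ₐ[k] L} {φ φ' : B ≃ₐ[k] B} (hF : IsRTrans st cop F φ)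
    (hF' : IsRTrans st cop F' φ') : IsRTrans st cop (F.comp F') (φ'.trans φ) where
  map_s b := by simp [hF'.map_s, hF.map_s]
  map_t b := by simp [hF'.map_t, hF.map_t]
  map_comul X := by
    rw [AlgHom.comp_apply, hF.map_comul, hF'.map_comul, map_lift2 hF'.bal2]
    simp only [lift2_mk2 hF.bal2, AlgHom.comp_apply]

theorem lift2_mk2_eq (z : st.T2) : st.lift2 (fun x y => st.mk2 x y) z = z :=
  LinearMap.congr_fun (T2_ext (F' := LinearMap.id) fun x y => lift2_mk2 bal2_mk2 x y) z

theorem isLTrans_id : IsLTrans st cop (AlgHom.id k L) AlgEquiv.refl where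
  map_s _ := rfl
  map_t _ := rfl
  map_comul _ := (lift2_mk2_eq _).symm

theorem isRTrans_id : IsRTrans st cop (AlgHom.id k L) AlgEquiv.refl where
  map_s _ := rfl
  map_t _ := rfl
  map_comul _ := (lift2_mk2_eq _).symm

theorem IsRTrans.ext (hbgd : st.IsLeftBialgebroid cop cou) {F F' : L →ₐ[k] L}
    {φ φ' : B ≃ₐ[k] B} (hF : IsRTrans st cop F φ) (hF' : IsRTrans st cop F' φ')
    (h : ∀ X, cou (F X) = cou (F' X)) : F = F' := by
  ext X
  rw [hF.eq_lift2 hbgd, hF'.eq_lift2 hbgd]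
  simp only [h]

/-- Left and right translations commute. -/
theorem IsLTrans.commute (hbgd : st.IsLeftBialgebroid cop cou) {G F : L →ₐ[k] L}
    {φ ψ : B ≃ₐ[k] B} (hG : IsLTrans st cop G φ) (hF : IsRTrans st cop F ψ) (X : L) :
    F (G X) = G (F X) := by
  have hbal : Bal2 st fun x y => st.s (cou (G x)) * y :=
    bal2_s (cou ∘ₗ G.toLinearMap) (hG.counit_t hbgd)
  rw [hG.eq_lift2 hbgd X, hG.eq_lift2 hbgd (F X), hF.map_comul, map_lift2 hF.bal2,
    ← AlgHom.toLinearMap_apply, map_lift2 hbal]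
  simp only [AlgHom.toLinearMap_apply, map_mul, hF.map_s, lift2_mk2 hbal]

/-- A right translation is determined by the counit of its composition with a surjective left
translation. -/
theorem IsRTrans.ext_of_comp (hbgd : st.IsLeftBialgebroid cop cou) {G F F' : L →ₐ[k] L}
    {φ ψ ψ' : B ≃ₐ[k] B} (hG : IsLTrans st cop G φ) (hGs : Function.Surjective G)
    (hF : IsRTrans st cop F ψ) (hF' : IsRTrans st cop F' ψ')
    (h : ∀ X, cou (G (F X)) = cou (G (F' X))) : F = F' :=
  hF.ext hbgd hF' fun X => by
    obtain ⟨X, rfl⟩ := hGs X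
    rw [hG.commute hbgd hF, hG.commute hbgd hF', h]

/-! ### Left bisections as left translations -/

theorem IsLeftBisection.mk_of_equiv {σ : L →ₗ[k] B} (φ : B ≃ₐ[k] B) (h1 : σ 1 = 1)
    (ht : ∀ b X, σ (st.t b * X) = σ X * b) (hs : ∀ b, σ (st.s b) = φ b)
    (hpt : ∀ X Y, σ (X * Y) = σ (X * st.t (σ Y)))
    (hps : ∀ X Y, σ (X * Y) = σ (X * st.s (φ.symm (σ Y)))) : st.IsLeftBisection σ where
  unital := h1
  t_prop := ht
  s_mul a b := by rw [hs, hs, hs, map_mul]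
  s_bij := by simpa only [hs] using φ.bijective
  prod_t := hpt
  prod_s X Y := by
    have h : Function.invFun (fun b => σ (st.s b)) (σ Y) = φ.symm (σ Y) := by
      apply φ.injective
      rw [← hs, φ.apply_symm_apply]
      exact Function.rightInverse_invFun (f := fun b => σ (st.s b))
        (by simpa only [hs] using φ.surjective) (σ Y)
    rw [h, hps]

theorem IsLTrans.isLeftBisection (hbgd : st.IsLeftBialgebroid cop cou) {G : L →ₐ[k] L}
    {φ : B ≃ₐ[k] B} (hG : IsLTrans st cop G φ) : st.IsLeftBisection (cou ∘ₗ G.toLinearMap) := by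
  refine .mk_of_equiv φ ?_ (hG.counit_t hbgd) ?_ ?_ ?_ <;>
    intros <;>
    simp only [LinearMap.comp_apply, AlgHom.toLinearMap_apply, map_one, map_mul, hG.map_s, hG.map_t,
      hbgd.counit_one, hbgd.counit_char_t, hbgd.counit_char_s, AlgEquiv.apply_symm_apply]
  rw [← mul_one (st.s _), hbgd.counit_s, hbgd.counit_one, mul_one]

namespace IsLeftBisection

variable {σ : L →ₗ[k] B} (hσ : st.IsLeftBisection σ)

/-- The automorphism of the base underlying a left bisection. -/
noncomputable def base : B ≃ₐ[k] B :=
  AlgEquiv.ofBijective (AlgHom.ofLinearMap (σ ∘ₗ st.s.toLinearMap)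
    (by simpa using hσ.unital) fun a b => hσ.s_mul a b) hσ.s_bij

theorem base_apply (b : B) : hσ.base b = σ (st.s b) := rfl

theorem apply_s_mul (b : B) (X : L) : σ (st.s b * X) = hσ.base b * σ X := by
  rw [hσ.prod_t, st.st_comm, hσ.t_prop, base_apply]

/-- The left translation `X ↦ s(σ(X₍₁₎)) X₍₂₎` attached to a left bisection. -/
noncomputable def leftTrans (hbgd : st.IsLeftBialgebroid cop cou) : L →ₐ[k] L :=
  AlgHom.ofLinearMap (st.lift2 (fun x y => st.s (σ x) * y) ∘ₗ cop)
    (by rw [LinearMap.comp_apply, hbgd.comul_one, lift2_mk2 (bal2_s σ hσ.t_prop), hσ.unital,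
      map_one, mul_one])
    (fun X Y => by
      have key : st.lift2 (fun x y => st.s (σ x) * y) ∘ₗ diag st cop X =
          LinearMap.mulLeft k (st.lift2 (fun x y => st.s (σ x) * y) (cop X)) ∘ₗ
            st.lift2 fun x y => st.s (σ x) * y := T2_ext fun y1 y2 => by
        have hbal : Bal2 st fun x y => st.s (σ x) * (y * y2) :=
          bal2_s_left (v := LinearMap.mulRight k y2) hσ.t_prop fun _ _ => mul_assoc _ _ _
        have ht := congrArg (st.lift2 fun x y => st.s (σ x) * (y * y2)) (hbgd.takeuchi (σ y1) X)
        have hm1 : Bal2 st fun x y => st.mk2 (x * st.t (σ y1)) y := by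
          simpa using bal2_mul (st := st) (st.t (σ y1)) 1
        have hm2 : Bal2 st fun x y => st.mk2 x (y * st.s (σ y1)) := by
          simpa using bal2_mul (st := st) 1 (st.s (σ y1))
        rw [map_lift2 hm1, map_lift2 hm2] at ht
        simp only [lift2_mk2 hbal, ← hσ.prod_t] at ht
        rw [LinearMap.comp_apply, LinearMap.comp_apply, diag_mk2 hbgd, rmul,
          map_lift2 (bal2_mul y1 y2), lift2_mk2 (bal2_s σ hσ.t_prop), LinearMap.mulLeft_apply,
          ← LinearMap.mulRight_apply (R := k), map_lift2 (bal2_s σ hσ.t_prop)]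
        simp only [lift2_mk2 (bal2_s σ hσ.t_prop), LinearMap.mulRight_apply]
        simpa only [mul_assoc] using ht
      rw [LinearMap.comp_apply, comul_mul_eq_diag hbgd]
      exact LinearMap.congr_fun key (cop Y))

theorem leftTrans_apply (hbgd : st.IsLeftBialgebroid cop cou) (X : L) :
    hσ.leftTrans hbgd X = st.lift2 (fun x y => st.s (σ x) * y) (cop X) := rfl

theorem isLTrans (hbgd : st.IsLeftBialgebroid cop cou) :
    IsLTrans st cop (hσ.leftTrans hbgd) hσ.base where
  map_s b := by
    rw [leftTrans_apply, comul_s_one hbgd, lift2_mk2 (bal2_s σ hσ.t_prop), mul_one, base_apply]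
  map_t b := by
    rw [leftTrans_apply, comul_t_one hbgd, lift2_mk2 (bal2_s σ hσ.t_prop), hσ.unital, map_one,
      one_mul]
  map_comul X := by
    have hbal : Bal3 st fun x y z => st.mk2 (st.s (σ x) * y) z :=
      { add₁ := fun x x' y z => by rw [map_add, map_add, add_mul, mk2_bilin.add_left]
        smul₁ := fun c x y z => by rw [map_smul, map_smul, smul_mul_assoc, mk2_bilin.smul_left]
        right := fun x => bal2_s_mul _
        left := fun z =>
          { add_left := fun x x' y => by rw [map_add, map_add, add_mul, mk2_bilin.add_left]
            add_right := fun x y y' => by rw [mul_add, mk2_bilin.add_left]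
            smul_left := fun c x y => by
              rw [map_smul, map_smul, smul_mul_assoc, mk2_bilin.smul_left]
            smul_right := fun c x y => by rw [mul_smul_comm, mk2_bilin.smul_left]
            bal := fun a x y => by rw [hσ.t_prop, map_mul, mul_assoc] } }
    have h := lift2_coassoc hbgd hbal X
    rw [leftTrans_apply, map_lift2 (bal2_s σ hσ.t_prop)]
    simp only [hbgd.comul_s]
    rw [h]
    congr 2
    funext x y
    rw [leftTrans_apply]
    exact (LinearMap.congr_fun (T2_ext (F := ((Bilin.toLin mk2_bilin).flip y) ∘ₗ
      st.lift2 (fun x y => st.s (σ x) * y)) (F' := st.lift2 fun u v => st.mk2 (st.s (σ u) * v) y)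
      fun u v => by
        rw [LinearMap.comp_apply, lift2_mk2 (bal2_s σ hσ.t_prop), lift2_mk2 (hbal.left y)]
        rfl) (cop x)).symm

theorem counit_leftTrans (hbgd : st.IsLeftBialgebroid cop cou) (X : L) :
    cou (hσ.leftTrans hbgd X) = σ X := by
  rw [leftTrans_apply, map_lift2 (bal2_s σ hσ.t_prop)]
  conv_rhs => rw [← hbgd.counit_comul_right X, map_lift2 (bal2_cou_t hbgd)]
  simp only [hbgd.counit_s, hσ.t_prop]

/-! ### Right translations from the canonical map -/

variable (st) in
/-- The map `X ⊗ Y ↦ X₊ t(σ(X₋ Y))` on `L ⊗_B L`. -/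
noncomputable def hopfMap (hHopf : st.IsLeftHopf cop) (σ : L →ₗ[k] B) : st.T2 →ₗ[k] L :=
  st.liftOp (fun p m => p * st.t (σ m)) ∘ₗ (LinearEquiv.ofBijective (st.lam cop) hHopf).symm

theorem hopfMap_mk2_one (hHopf : st.IsLeftHopf cop) (X : L) :
    hopfMap st hHopf σ (st.mk2 X 1) =
      st.liftOp (fun p m => p * st.t (σ m)) (st.plusMinus cop X) := by
  rw [hopfMap, LinearMap.comp_apply]
  congr 1
  refine (LinearEquiv.ofBijective (st.lam cop) hHopf).injective ?_
  rw [LinearEquiv.coe_coe, LinearEquiv.apply_symm_apply]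
  exact (Function.rightInverse_invFun hHopf.2 _).symm

section

include hσ

theorem hopfMap_diag (hbgd : st.IsLeftBialgebroid cop cou) (hHopf : st.IsLeftHopf cop)
    (p m : L) : hopfMap st hHopf σ (diag st cop p (st.mk2 1 m)) = p * st.t (σ m) := by
  have hbal : BalOp st fun p m => p * st.t (σ m) :=
    { add_left := fun x x' y => add_mul _ _ _
      add_right := fun x y y' => by rw [map_add, map_add, mul_add]
      smul_left := fun c x y => smul_mul_assoc _ _ _
      smul_right := fun c x y => by rw [map_smul, map_smul, mul_smul_comm]
      bal := fun a x y => by rw [hσ.t_prop, st.t_mul, mul_assoc] }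
  rw [hopfMap, LinearMap.comp_apply, ← lam_mkOp hbgd]
  exact (congrArg _ ((LinearEquiv.ofBijective (st.lam cop) hHopf).symm_apply_apply _)).trans
    (liftOp_mkOp hbal p m)

theorem hopfMap_diag_apply (hbgd : st.IsLeftBialgebroid cop cou) (hHopf : st.IsLeftHopf cop)
    (p : L) (z : st.T2) :
    hopfMap st hHopf σ (diag st cop p z) = p * hopfMap st hHopf σ z :=
  LinearMap.congr_fun (T2_ext_of_isLeftHopf hbgd hHopf
    (F := hopfMap st hHopf σ ∘ₗ diag st cop p) (F' := LinearMap.mulLeft k p ∘ₗ hopfMap st hHopf σ)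
    fun q m => by
      rw [LinearMap.comp_apply, LinearMap.comp_apply, ← diag_mul hbgd, hσ.hopfMap_diag hbgd,
        hσ.hopfMap_diag hbgd, LinearMap.mulLeft_apply, mul_assoc]) z

theorem hopfMap_one (hbgd : st.IsLeftBialgebroid cop cou) (hHopf : st.IsLeftHopf cop) :
    hopfMap st hHopf σ (st.mk2 1 1) = 1 := by
  have h := hσ.hopfMap_diag hbgd hHopf 1 1
  rwa [diag_mk2 hbgd, rmul_one_one, hbgd.comul_one, hσ.unital, st.t_one, mul_one] at h

theorem hopfMap_rmul (hbgd : st.IsLeftBialgebroid cop cou) (hHopf : st.IsLeftHopf cop)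
    (Y : L) (z : st.T2) :
    hopfMap st hHopf σ (rmul st 1 Y z) = hopfMap st hHopf σ (rmul st 1 (st.t (σ Y)) z) :=
  LinearMap.congr_fun (T2_ext_of_isLeftHopf hbgd hHopf
    (F := hopfMap st hHopf σ ∘ₗ rmul st 1 Y)
    (F' := hopfMap st hHopf σ ∘ₗ rmul st 1 (st.t (σ Y))) fun p m => by
      simp only [LinearMap.comp_apply, rmul_diag hbgd, rmul_mk2, mul_one, hσ.hopfMap_diag hbgd]
      rw [hσ.prod_t]) z

theorem hopfMap_mk2 (hbgd : st.IsLeftBialgebroid cop cou) (hHopf : st.IsLeftHopf cop)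
    (X Y : L) :
    hopfMap st hHopf σ (st.mk2 X Y) = st.t (σ Y) * hopfMap st hHopf σ (st.mk2 X 1) := by
  have h := hσ.hopfMap_rmul hbgd hHopf Y (st.mk2 X 1)
  rw [rmul_mk2, rmul_mk2, mul_one, one_mul, one_mul] at h
  rw [h, ← hσ.hopfMap_diag_apply hbgd, diag_t hbgd, mul_one]

theorem hopfMap_mul (hbgd : st.IsLeftBialgebroid cop cou) (hHopf : st.IsLeftHopf cop)
    (Y : L) (z : st.T2) :
    hopfMap st hHopf σ (rmul st Y 1 z) =
      hopfMap st hHopf σ z * hopfMap st hHopf σ (st.mk2 Y 1) :=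
  LinearMap.congr_fun (T2_ext_of_isLeftHopf hbgd hHopf
    (F := hopfMap st hHopf σ ∘ₗ rmul st Y 1)
    (F' := LinearMap.mulRight k (hopfMap st hHopf σ (st.mk2 Y 1)) ∘ₗ hopfMap st hHopf σ)
    fun p m => by
      rw [LinearMap.comp_apply, LinearMap.comp_apply, rmul_diag hbgd, rmul_mk2, one_mul, mul_one,
        hσ.hopfMap_diag_apply hbgd, hσ.hopfMap_mk2 hbgd, LinearMap.mulRight_apply,
        hσ.hopfMap_diag hbgd, mul_assoc]) z

/-- The right translation `X ↦ X₊ t(σ(X₋))` attached to a left bisection. -/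
noncomputable def rightTrans (hbgd : st.IsLeftBialgebroid cop cou) (hHopf : st.IsLeftHopf cop) :
    L →ₐ[k] L :=
  AlgHom.ofLinearMap (hopfMap st hHopf σ ∘ₗ (Bilin.toLin (mk2_bilin (st := st))).flip 1)
    (hσ.hopfMap_one hbgd hHopf) fun X Y => by
      have h := hσ.hopfMap_mul hbgd hHopf Y (st.mk2 X 1)
      rwa [rmul_mk2, mul_one] at h

theorem rightTrans_apply (hbgd : st.IsLeftBialgebroid cop cou) (hHopf : st.IsLeftHopf cop)
    (X : L) : hσ.rightTrans hbgd hHopf X = hopfMap st hHopf σ (st.mk2 X 1) := rfl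

theorem bal3_hopfMap (hbgd : st.IsLeftBialgebroid cop cou) (hHopf : st.IsLeftHopf cop) (m : L) :
    Bal3 st fun x y z => st.mk2 x (hopfMap st hHopf σ (st.mk2 y (z * m))) where
  add₁ x x' y z := mk2_bilin.add_left _ _ _
  smul₁ c x y z := mk2_bilin.smul_left _ _ _
  right x :=
    { add_left := fun y y' z => by rw [mk2_bilin.add_left, map_add, mk2_bilin.add_right]
      add_right := fun y z z' => by
        rw [add_mul, mk2_bilin.add_right, map_add, mk2_bilin.add_right]
      smul_left := fun c y z => by rw [mk2_bilin.smul_left, map_smul, mk2_bilin.smul_right]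
      smul_right := fun c y z => by
        rw [smul_mul_assoc, mk2_bilin.smul_right, map_smul, mk2_bilin.smul_right]
      bal := fun a y z => by rw [mk2_bal, mul_assoc] }
  left z :=
    { add_left := fun x x' y => mk2_bilin.add_left _ _ _
      add_right := fun x y y' => by rw [mk2_bilin.add_left, map_add, mk2_bilin.add_right]
      smul_left := fun c x y => mk2_bilin.smul_left _ _ _
      smul_right := fun c x y => by rw [mk2_bilin.smul_left, map_smul, mk2_bilin.smul_right]
      bal := fun a x y => by
        rw [mk2_bal, ← diag_s hbgd, hσ.hopfMap_diag_apply hbgd] }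

theorem comul_hopfMap (hbgd : st.IsLeftBialgebroid cop cou) (hHopf : st.IsLeftHopf cop)
    (z : st.T2) :
    cop (hopfMap st hHopf σ z) = st.lift2 (fun x y => st.lift2
      (fun x1 x2 => st.mk2 x1 (hopfMap st hHopf σ (st.mk2 x2 y))) (cop x)) z := by
  have hbal := (hσ.bal3_hopfMap hbgd hHopf 1).bal2_left hbgd
  simp only [mul_one] at hbal
  refine LinearMap.congr_fun (T2_ext_of_isLeftHopf hbgd hHopf (F := cop ∘ₗ hopfMap st hHopf σ)
    fun p m => ?_) z
  have hm : Bal2 st fun x y => st.mk2 x (y * m) := by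
    simpa using bal2_mul (st := st) 1 m
  have h := lift2_coassoc hbgd (hσ.bal3_hopfMap hbgd hHopf m) p
  have hinner : ∀ x1 x2 : L, st.lift2 (fun y1 y2 => st.mk2 x1
      (hopfMap st hHopf σ (st.mk2 y1 (y2 * m)))) (cop x2) = st.mk2 x1 (x2 * st.t (σ m)) := by
    intro x1 x2
    rw [← hσ.hopfMap_diag hbgd hHopf, diag_mk2 hbgd, rmul_one_apply]
    exact (map_lift2 hm ((Bilin.toLin (mk2_bilin (st := st))) x1 ∘ₗ hopfMap st hHopf σ)
      (cop x2)).symm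
  simp only [hinner] at h
  rw [LinearMap.comp_apply, hσ.hopfMap_diag hbgd, comul_mul_eq_diag hbgd, comul_t_one hbgd,
    diag_mk2 hbgd, diag_mk2 hbgd, rmul_one_apply, rmul_one_apply, map_lift2 hm, h]
  simp only [lift2_mk2 hbal]

theorem isRTrans (hbgd : st.IsLeftBialgebroid cop cou) (hHopf : st.IsLeftHopf cop) :
    IsRTrans st cop (hσ.rightTrans hbgd hHopf) hσ.base where
  map_s b := by
    rw [rightTrans_apply, ← mul_one (st.s b), ← diag_s hbgd, hσ.hopfMap_diag_apply hbgd,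
      hσ.hopfMap_one hbgd]
  map_t b := by
    rw [rightTrans_apply, ← mul_one (st.t b), mk2_bal, mul_one, hσ.hopfMap_mk2 hbgd,
      hσ.hopfMap_one hbgd, mul_one, base_apply]
  map_comul X := by
    have hbal := (hσ.bal3_hopfMap hbgd hHopf 1).bal2_left hbgd
    simp only [mul_one] at hbal
    rw [rightTrans_apply, hσ.comul_hopfMap hbgd, lift2_mk2 hbal]
    rfl

theorem apply_hopfMap (hbgd : st.IsLeftBialgebroid cop cou) (hHopf : st.IsLeftHopf cop)
    (z : st.T2) :
    σ (hopfMap st hHopf σ z) = σ (st.lift2 (fun x y => st.s (cou x) * y) z) :=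
  LinearMap.congr_fun (T2_ext_of_isLeftHopf hbgd hHopf (F := σ ∘ₗ hopfMap st hHopf σ)
    (F' := σ ∘ₗ st.lift2 fun x y => st.s (cou x) * y) fun p m => by
      have hm : Bal2 st fun x y => st.mk2 x (y * m) := by
        simpa using bal2_mul (st := st) 1 m
      rw [LinearMap.comp_apply, LinearMap.comp_apply, hσ.hopfMap_diag hbgd, ← hσ.prod_t,
        diag_mk2 hbgd, rmul_one_apply, map_lift2 hm]
      simp only [lift2_mk2 (bal2_cou_s hbgd), ← mul_assoc]
      conv_lhs => rw [← hbgd.counit_comul_left p]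
      exact congrArg σ (map_lift2 (bal2_cou_s hbgd) (LinearMap.mulRight k m) (cop p))) z

theorem apply_rightTrans (hbgd : st.IsLeftBialgebroid cop cou) (hHopf : st.IsLeftHopf cop)
    (X : L) : σ (hσ.rightTrans hbgd hHopf X) = hσ.base (cou X) := by
  rw [rightTrans_apply, hσ.apply_hopfMap hbgd, lift2_mk2 (bal2_cou_s hbgd), mul_one, base_apply]

theorem adL_eq (hbgd : st.IsLeftBialgebroid cop cou) (hHopf : st.IsLeftHopf cop) (X : L) :
    st.adL cop σ X = hσ.leftTrans hbgd (hσ.rightTrans hbgd hHopf X) := by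
  have hF := hσ.isRTrans hbgd hHopf
  rw [leftTrans_apply, hF.map_comul, map_lift2 hF.bal2]
  simp only [lift2_mk2 (bal2_s σ hσ.t_prop), adL, ← hopfMap_mk2_one hHopf, rightTrans_apply]

/-- The convolution inverse `X ↦ φ⁻¹(ε(X₊ t(σ(X₋))))` of a left bisection. -/
theorem isLeftBisection_inv (hbgd : st.IsLeftBialgebroid cop cou) (hHopf : st.IsLeftHopf cop) :
    st.IsLeftBisection (hσ.base.symm.toLinearMap ∘ₗ cou ∘ₗ
      (hσ.rightTrans hbgd hHopf).toLinearMap) := by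
  have hF := hσ.isRTrans hbgd hHopf
  refine .mk_of_equiv hσ.base.symm ?_ ?_ ?_ ?_ ?_ <;>
    intros <;>
    simp only [LinearMap.comp_apply, AlgHom.toLinearMap_apply, AlgEquiv.toLinearMap_apply, map_one,
      map_mul, hF.map_s, hF.map_t, hbgd.counit_one, hbgd.counit_char_t, hbgd.counit_char_s,
      AlgEquiv.apply_symm_apply, AlgEquiv.symm_apply_apply, hbgd.counit_t, AlgEquiv.symm_symm]
  rw [← mul_one (st.s _), hbgd.counit_s, hbgd.counit_one, mul_one]

end

end IsLeftBisection
/-! ### The group of left bisections -/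

theorem isLeftBisection_counit (hbgd : st.IsLeftBialgebroid cop cou) : st.IsLeftBisection cou :=
  isLTrans_id.isLeftBisection hbgd

namespace IsLeftBisection

variable {σ η : L →ₗ[k] B} (hσ : st.IsLeftBisection σ) (hη : st.IsLeftBisection η)

include hσ hη

omit hσ in
theorem bconv_apply (hbgd : st.IsLeftBialgebroid cop cou) (X : L) :
    st.bconv cop σ η X = σ (hη.leftTrans hbgd X) := by
  rw [leftTrans_apply, map_lift2 (bal2_s η hη.t_prop)]
  rfl

theorem bconv_eq (hbgd : st.IsLeftBialgebroid cop cou) :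
    st.bconv cop σ η =
      cou ∘ₗ ((hσ.leftTrans hbgd).comp (hη.leftTrans hbgd)).toLinearMap :=
  LinearMap.ext fun X => (hη.bconv_apply hbgd X).trans (hσ.counit_leftTrans hbgd _).symm

theorem bconv (hbgd : st.IsLeftBialgebroid cop cou) : st.IsLeftBisection (st.bconv cop σ η) := by
  rw [hσ.bconv_eq hη hbgd]
  exact ((hσ.isLTrans hbgd).comp (hη.isLTrans hbgd)).isLeftBisection hbgd

omit hη in
theorem leftTrans_eq (hbgd : st.IsLeftBialgebroid cop cou) {G : L →ₐ[k] L} {φ : B ≃ₐ[k] B}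
    (hG : IsLTrans st cop G φ) (h : ∀ X, σ X = cou (G X)) : hσ.leftTrans hbgd = G := by
  ext X
  rw [hG.eq_lift2 hbgd, leftTrans_apply]
  simp only [h]

theorem leftTrans_bconv (hbgd : st.IsLeftBialgebroid cop cou) :
    (hσ.bconv hη hbgd).leftTrans hbgd = (hσ.leftTrans hbgd).comp (hη.leftTrans hbgd) :=
  leftTrans_eq _ hbgd ((hσ.isLTrans hbgd).comp (hη.isLTrans hbgd)) fun X =>
    LinearMap.congr_fun (hσ.bconv_eq hη hbgd) X

theorem base_bconv (hbgd : st.IsLeftBialgebroid cop cou) (b : B) :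
    (hσ.bconv hη hbgd).base b = hσ.base (hη.base b) := by
  rw [base_apply, bconv_apply hη hbgd, (hη.isLTrans hbgd).map_s, base_apply hσ]

omit hη in
theorem rightTrans_eq (hbgd : st.IsLeftBialgebroid cop cou) (hHopf : st.IsLeftHopf cop)
    (hGs : Function.Surjective (hσ.leftTrans hbgd)) {F : L →ₐ[k] L} {φ : B ≃ₐ[k] B}
    (hF : IsRTrans st cop F φ) (h : ∀ X, σ (F X) = hσ.base (cou X)) :
    hσ.rightTrans hbgd hHopf = F :=
  (hσ.isRTrans hbgd hHopf).ext_of_comp hbgd (hσ.isLTrans hbgd) hGs hF fun X => by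
    rw [counit_leftTrans, counit_leftTrans, h, apply_rightTrans]

end IsLeftBisection

/-- The group of left bisections of a left Hopf algebroid. -/
noncomputable abbrev bisectionGroup (hbgd : st.IsLeftBialgebroid cop cou)
    (hHopf : st.IsLeftHopf cop) : Group {σ : L →ₗ[k] B // st.IsLeftBisection σ} :=
  letI : Mul {σ : L →ₗ[k] B // st.IsLeftBisection σ} :=
    ⟨fun σ η => ⟨st.bconv cop σ.1 η.1, σ.2.bconv η.2 hbgd⟩⟩
  letI : Inv {σ : L →ₗ[k] B // st.IsLeftBisection σ} :=
    ⟨fun σ => ⟨_, σ.2.isLeftBisection_inv hbgd hHopf⟩⟩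
  letI : One {σ : L →ₗ[k] B // st.IsLeftBisection σ} := ⟨⟨cou, isLeftBisection_counit hbgd⟩⟩
  Group.ofLeftAxioms
    (fun σ η τ => Subtype.ext <| LinearMap.ext fun X => by
      refine (τ.2.bconv_apply (σ := st.bconv cop σ.1 η.1) hbgd X).trans ?_
      refine Eq.trans ?_ ((η.2.bconv τ.2 hbgd).bconv_apply hbgd X).symm
      rw [η.2.leftTrans_bconv τ.2, η.2.bconv_apply hbgd, AlgHom.comp_apply])
    (fun σ => Subtype.ext <| LinearMap.ext fun X =>
      (σ.2.bconv_apply hbgd X).trans (σ.2.counit_leftTrans hbgd X))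
    (fun σ => Subtype.ext <| LinearMap.ext fun X => by
      refine (σ.2.bconv_apply hbgd X).trans ?_
      change σ.2.base.symm (cou (σ.2.rightTrans hbgd hHopf (σ.2.leftTrans hbgd X))) = cou X
      rw [(σ.2.isLTrans hbgd).commute hbgd (σ.2.isRTrans hbgd hHopf), σ.2.counit_leftTrans,
        σ.2.apply_rightTrans]
      exact σ.2.base.symm_apply_apply _)

namespace IsLeftBisection

variable {σ η : L →ₗ[k] B} (hσ : st.IsLeftBisection σ) (hη : st.IsLeftBisection η)

include hσ

theorem exists_inv (hbgd : st.IsLeftBialgebroid cop cou) (hHopf : st.IsLeftHopf cop) :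
    ∃ τ : L →ₗ[k] B, st.IsLeftBisection τ ∧ st.bconv cop σ τ = cou ∧ st.bconv cop τ σ = cou := by
  let _ := bisectionGroup hbgd hHopf
  let σ' : {σ : L →ₗ[k] B // st.IsLeftBisection σ} := ⟨σ, hσ⟩
  exact ⟨σ'⁻¹.1, σ'⁻¹.2, congrArg Subtype.val (mul_inv_cancel σ'),
    congrArg Subtype.val (inv_mul_cancel σ')⟩

theorem leftTrans_of_eq_counit (hbgd : st.IsLeftBialgebroid cop cou) (h : σ = cou) :
    hσ.leftTrans hbgd = AlgHom.id k L :=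
  hσ.leftTrans_eq hbgd isLTrans_id fun X => by rw [h]; rfl

theorem leftTrans_bijective (hbgd : st.IsLeftBialgebroid cop cou) (hHopf : st.IsLeftHopf cop) :
    Function.Bijective (hσ.leftTrans hbgd) := by
  obtain ⟨τ, hτ, h1, h2⟩ := hσ.exists_inv hbgd hHopf
  have e1 := (hσ.leftTrans_bconv hτ hbgd).symm.trans (leftTrans_of_eq_counit _ hbgd h1)
  have e2 := (hτ.leftTrans_bconv hσ hbgd).symm.trans (leftTrans_of_eq_counit _ hbgd h2)
  exact Function.bijective_iff_has_inverse.2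
    ⟨hτ.leftTrans hbgd, DFunLike.congr_fun e2, DFunLike.congr_fun e1⟩

include hη in
theorem rightTrans_bconv (hbgd : st.IsLeftBialgebroid cop cou) (hHopf : st.IsLeftHopf cop) :
    (hσ.bconv hη hbgd).rightTrans hbgd hHopf =
      (hσ.rightTrans hbgd hHopf).comp (hη.rightTrans hbgd hHopf) :=
  rightTrans_eq _ hbgd hHopf (leftTrans_bijective _ hbgd hHopf).2
    ((hσ.isRTrans hbgd hHopf).comp (hη.isRTrans hbgd hHopf)) fun X => by
      rw [hη.bconv_apply hbgd, hσ.base_bconv hη hbgd, AlgHom.comp_apply,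
        ← (hη.isLTrans hbgd).commute hbgd (hσ.isRTrans hbgd hHopf), apply_rightTrans,
        counit_leftTrans, apply_rightTrans]

theorem rightTrans_of_eq_counit (hbgd : st.IsLeftBialgebroid cop cou) (hHopf : st.IsLeftHopf cop)
    (h : σ = cou) : hσ.rightTrans hbgd hHopf = AlgHom.id k L :=
  rightTrans_eq _ hbgd hHopf (leftTrans_bijective _ hbgd hHopf).2 isRTrans_id fun X => by
    subst h
    rw [base_apply, ← mul_one (st.s _), hbgd.counit_s, hbgd.counit_one, mul_one]
    rfl

theorem exists_rightTrans_inv (hbgd : st.IsLeftBialgebroid cop cou)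
    (hHopf : st.IsLeftHopf cop) : ∃ (F : L →ₐ[k] L) (φ : B ≃ₐ[k] B), IsRTrans st cop F φ ∧
      (∀ X, F (hσ.rightTrans hbgd hHopf X) = X) ∧ ∀ X, hσ.rightTrans hbgd hHopf (F X) = X := by
  obtain ⟨τ, hτ, h1, h2⟩ := hσ.exists_inv hbgd hHopf
  have e1 := (hσ.rightTrans_bconv hτ hbgd hHopf).symm.trans
    (rightTrans_of_eq_counit _ hbgd hHopf h1)
  have e2 := (hτ.rightTrans_bconv hσ hbgd hHopf).symm.trans
    (rightTrans_of_eq_counit _ hbgd hHopf h2)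
  exact ⟨_, _, hτ.isRTrans hbgd hHopf, DFunLike.congr_fun e2, DFunLike.congr_fun e1⟩

theorem rightTrans_bijective (hbgd : st.IsLeftBialgebroid cop cou) (hHopf : st.IsLeftHopf cop) :
    Function.Bijective (hσ.rightTrans hbgd hHopf) := by
  obtain ⟨F, _, _, h1, h2⟩ := hσ.exists_rightTrans_inv hbgd hHopf
  exact Function.bijective_iff_has_inverse.2 ⟨F, h1, h2⟩

/-- The identity `t(σ(X₍₂₎)) X₍₁₎₊ t(σ(X₍₁₎₋)) = X`. -/
theorem lift2_t_rightTrans (hbgd : st.IsLeftBialgebroid cop cou) (hHopf : st.IsLeftHopf cop)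
    (X : L) :
    st.lift2 (fun x y => st.t (σ y) * hσ.rightTrans hbgd hHopf x) (cop X) = X := by
  obtain ⟨F, φ, hF, -, h⟩ := hσ.exists_rightTrans_inv hbgd hHopf
  have hR := hσ.isRTrans hbgd hHopf
  have key : ∀ x y, st.t (σ y) * hσ.rightTrans hbgd hHopf x =
      (hσ.rightTrans hbgd hHopf).toLinearMap (st.t (cou (F y)) * x) := fun x y => by
    rw [AlgHom.toLinearMap_apply, map_mul, hR.map_t, ← hσ.apply_rightTrans hbgd hHopf, h]
  have hbal : Bal2 st fun x y => st.t (cou (F y)) * x :=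
    bal2_t_right (ρ := cou ∘ₗ F.toLinearMap) (φ := id) (u := LinearMap.id)
      (fun a X => by
        rw [LinearMap.comp_apply, AlgHom.toLinearMap_apply, map_mul, hF.map_s, hbgd.counit_s]
        rfl)
      fun _ _ => rfl
  simp only [key]
  rw [← map_lift2 hbal, ← hF.eq_lift2 hbgd, AlgHom.toLinearMap_apply, h]

theorem bal2_rightTrans_leftTrans (hbgd : st.IsLeftBialgebroid cop cou)
    (hHopf : st.IsLeftHopf cop) :
    Bal2 st fun x y => st.mk2 (hσ.rightTrans hbgd hHopf x) (hσ.leftTrans hbgd y) :=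
  bal2_mk2_map (u := (hσ.rightTrans hbgd hHopf).toLinearMap)
    (v := (hσ.leftTrans hbgd).toLinearMap) hσ.base
    (fun a x => by rw [AlgHom.toLinearMap_apply, map_mul, (hσ.isRTrans hbgd hHopf).map_t]; rfl)
    (fun a x => by rw [AlgHom.toLinearMap_apply, map_mul, (hσ.isLTrans hbgd).map_s]; rfl)

theorem lift2_rightTrans_leftTrans (hbgd : st.IsLeftBialgebroid cop cou)
    (hHopf : st.IsLeftHopf cop) (X : L) :
    st.lift2 (fun x y => st.mk2 (hσ.rightTrans hbgd hHopf x) (hσ.leftTrans hbgd y)) (cop X) =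
      cop X := by
  have hleft : Bal2 st fun x y => st.t (σ y) * hσ.rightTrans hbgd hHopf x :=
    bal2_t_right (φ := hσ.base) (u := (hσ.rightTrans hbgd hHopf).toLinearMap) hσ.apply_s_mul
      fun a x => by
        rw [AlgHom.toLinearMap_apply, map_mul, (hσ.isRTrans hbgd hHopf).map_t]
        rfl
  have hbal : Bal3 st fun x y z => st.mk2 (st.t (σ y) * hσ.rightTrans hbgd hHopf x) z :=
    { add₁ := fun x x' y z => by rw [map_add, mul_add, mk2_bilin.add_left]
      smul₁ := fun c x y z => by rw [map_smul, mul_smul_comm, mk2_bilin.smul_left]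
      right := fun x =>
        { add_left := fun y y' z => by rw [hleft.add_right, mk2_bilin.add_left]
          add_right := fun y z z' => mk2_bilin.add_right _ _ _
          smul_left := fun c y z => by rw [hleft.smul_right, mk2_bilin.smul_left]
          smul_right := fun c y z => mk2_bilin.smul_right _ _ _
          bal := fun a y z => by rw [hσ.t_prop, st.t_mul, mul_assoc, mk2_bal] }
      left := fun z =>
        { add_left := fun x x' y => by rw [hleft.add_left, mk2_bilin.add_left]
          add_right := fun x y y' => by rw [hleft.add_right, mk2_bilin.add_left]
          smul_left := fun c x y => by rw [hleft.smul_left, mk2_bilin.smul_left]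
          smul_right := fun c x y => by rw [hleft.smul_right, mk2_bilin.smul_left]
          bal := fun a x y => by rw [hleft.bal] } }
  have h := lift2_coassoc hbgd hbal X
  have h1 : ∀ x y : L, st.lift2 (fun y1 y2 =>
      st.mk2 (st.t (σ y1) * hσ.rightTrans hbgd hHopf x) y2) (cop y) =
      st.mk2 (hσ.rightTrans hbgd hHopf x) (hσ.leftTrans hbgd y) := fun x y => by
    simp only [mk2_bal]
    rw [leftTrans_apply]
    exact (map_lift2 (bal2_s σ hσ.t_prop) ((Bilin.toLin (mk2_bilin (st := st))) _) (cop y)).symm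
  have h2 : ∀ x z : L, st.lift2 (fun x1 x2 =>
      st.mk2 (st.t (σ x2) * hσ.rightTrans hbgd hHopf x1) z) (cop x) = st.mk2 x z := fun x z => by
    conv_rhs => rw [← hσ.lift2_t_rightTrans hbgd hHopf x]
    exact (map_lift2 hleft ((Bilin.toLin (mk2_bilin (st := st))).flip z) (cop x)).symm
  simp only [h1, h2] at h
  rw [h, lift2_mk2_eq]

/-- The adjoint map of a left bisection is an automorphism of the left bialgebroid. -/
theorem isBgdAut (hbgd : st.IsLeftBialgebroid cop cou) (hHopf : st.IsLeftHopf cop) :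
    st.IsBgdAut cop cou ((hσ.leftTrans hbgd).comp (hσ.rightTrans hbgd hHopf))
      (hσ.base : B →ₐ[k] B) where
  bijL := (hσ.leftTrans_bijective hbgd hHopf).comp (hσ.rightTrans_bijective hbgd hHopf)
  bijB := hσ.base.bijective
  comp_s b := by
    rw [AlgHom.comp_apply, (hσ.isRTrans hbgd hHopf).map_s, (hσ.isLTrans hbgd).map_s]; rfl
  comp_t b := by
    rw [AlgHom.comp_apply, (hσ.isRTrans hbgd hHopf).map_t, (hσ.isLTrans hbgd).map_t]; rfl
  comp_comul X := by
    have hF := hσ.isRTrans hbgd hHopf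
    have hG := hσ.isLTrans hbgd
    have hbal : Bal2 st fun x y =>
        st.mk2 (hσ.leftTrans hbgd x) (hσ.rightTrans hbgd hHopf y) :=
      bal2_mk2_map (u := (hσ.leftTrans hbgd).toLinearMap)
        (v := (hσ.rightTrans hbgd hHopf).toLinearMap) id
        (fun a x => by rw [AlgHom.toLinearMap_apply, map_mul, hG.map_t]; rfl)
        (fun a x => by rw [AlgHom.toLinearMap_apply, map_mul, hF.map_s]; rfl)
    rw [AlgHom.comp_apply, hG.map_comul, hF.map_comul, map_lift2 hF.bal2]
    simp only [lift2_mk2 hG.bal2]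
    conv_lhs => rw [← hσ.lift2_rightTrans_leftTrans hbgd hHopf X,
      map_lift2 (hσ.bal2_rightTrans_leftTrans hbgd hHopf)]
    simp only [lift2_mk2 hbal, AlgHom.comp_apply, hG.commute hbgd hF]
  comp_counit X := by
    rw [AlgHom.comp_apply, counit_leftTrans, apply_rightTrans]; rfl

end IsLeftBisection

/-! ### The group of automorphisms and its action on bisections -/

namespace IsBgdAut

variable {Φ Ψ : L →ₐ[k] L} {φ ψ : B →ₐ[k] B} (hΦ : st.IsBgdAut cop cou Φ φ)
  (hΨ : st.IsBgdAut cop cou Ψ ψ)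

include hΦ in
theorem bal2 : Bal2 st fun x y => st.mk2 (Φ x) (Φ y) :=
  bal2_mk2_map (u := Φ.toLinearMap) (v := Φ.toLinearMap) φ
    (fun a x => by rw [AlgHom.toLinearMap_apply, map_mul, hΦ.comp_t]; rfl)
    (fun a x => by rw [AlgHom.toLinearMap_apply, map_mul, hΦ.comp_s]; rfl)

protected theorem id : st.IsBgdAut cop cou (AlgHom.id k L) (AlgHom.id k B) where
  bijL := Function.bijective_id
  bijB := Function.bijective_id
  comp_s _ := rfl
  comp_t _ := rfl
  comp_comul _ := (lift2_mk2_eq _).symm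
  comp_counit _ := rfl

include hΦ hΨ in
theorem comp : st.IsBgdAut cop cou (Φ.comp Ψ) (φ.comp ψ) where
  bijL := hΦ.bijL.comp hΨ.bijL
  bijB := hΦ.bijB.comp hΨ.bijB
  comp_s b := by simp only [AlgHom.comp_apply, hΨ.comp_s, hΦ.comp_s]
  comp_t b := by simp only [AlgHom.comp_apply, hΨ.comp_t, hΦ.comp_t]
  comp_comul X := by
    rw [AlgHom.comp_apply, hΦ.comp_comul, hΨ.comp_comul, map_lift2 hΨ.bal2]
    simp only [lift2_mk2 hΦ.bal2, AlgHom.comp_apply]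
  comp_counit X := by simp only [AlgHom.comp_apply, hΨ.comp_counit, hΦ.comp_counit]

/-- The inverse of the total part of an automorphism. -/
noncomputable def invL : L →ₐ[k] L := (AlgEquiv.ofBijective Φ hΦ.bijL).symm

/-- The inverse of the base part of an automorphism. -/
noncomputable def invB : B →ₐ[k] B := (AlgEquiv.ofBijective φ hΦ.bijB).symm

theorem invL_apply (X : L) : hΦ.invL (Φ X) = X :=
  (AlgEquiv.ofBijective Φ hΦ.bijL).symm_apply_apply X

theorem apply_invL (X : L) : Φ (hΦ.invL X) = X :=
  (AlgEquiv.ofBijective Φ hΦ.bijL).apply_symm_apply X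

theorem invB_apply (b : B) : hΦ.invB (φ b) = b :=
  (AlgEquiv.ofBijective φ hΦ.bijB).symm_apply_apply b

theorem apply_invB (b : B) : φ (hΦ.invB b) = b :=
  (AlgEquiv.ofBijective φ hΦ.bijB).apply_symm_apply b

theorem inv : st.IsBgdAut cop cou hΦ.invL hΦ.invB where
  bijL := (AlgEquiv.ofBijective Φ hΦ.bijL).symm.bijective
  bijB := (AlgEquiv.ofBijective φ hΦ.bijB).symm.bijective
  comp_s b := hΦ.bijL.1 (by rw [apply_invL, hΦ.comp_s, apply_invB])
  comp_t b := hΦ.bijL.1 (by rw [apply_invL, hΦ.comp_t, apply_invB])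
  comp_comul X := by
    have hinv : Bal2 st fun x y => st.mk2 (hΦ.invL x) (hΦ.invL y) :=
      bal2_mk2_map (u := hΦ.invL.toLinearMap) (v := hΦ.invL.toLinearMap) hΦ.invB
        (fun a x => hΦ.bijL.1 (by
          simp only [AlgHom.toLinearMap_apply, apply_invL, map_mul, hΦ.comp_t, apply_invB]))
        (fun a x => hΦ.bijL.1 (by
          simp only [AlgHom.toLinearMap_apply, apply_invL, map_mul, hΦ.comp_s, apply_invB]))
    obtain ⟨X, rfl⟩ := hΦ.bijL.2 X
    rw [invL_apply, hΦ.comp_comul, map_lift2 hΦ.bal2]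
    simp only [lift2_mk2 hinv, invL_apply, lift2_mk2_eq]
  comp_counit X := hΦ.bijB.1 (by rw [← hΦ.comp_counit, apply_invL, apply_invB])

theorem isLTrans_conj {G : L →ₐ[k] L} {χ : B ≃ₐ[k] B} (hG : IsLTrans st cop G χ) :
    IsLTrans st cop (Φ.comp (G.comp hΦ.invL)) ((AlgEquiv.ofBijective φ hΦ.bijB).symm.trans
      (χ.trans (AlgEquiv.ofBijective φ hΦ.bijB))) where
  map_s b := by
    simp only [AlgHom.comp_apply, hΦ.inv.comp_s, hG.map_s, hΦ.comp_s]
    rfl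
  map_t b := by simp only [AlgHom.comp_apply, hΦ.inv.comp_t, hG.map_t, hΦ.comp_t, apply_invB]
  map_comul X := by
    have hbal : Bal2 st fun x y => st.mk2 (Φ (G x)) (Φ y) :=
      bal2_mk2_map (u := (Φ.comp G).toLinearMap) (v := Φ.toLinearMap) φ
        (fun a x => by
          simp only [AlgHom.toLinearMap_apply, AlgHom.comp_apply, map_mul, hG.map_t, hΦ.comp_t])
        (fun a x => by simp only [AlgHom.toLinearMap_apply, map_mul, hΦ.comp_s])
    simp only [AlgHom.comp_apply]
    rw [hΦ.comp_comul, hG.map_comul, hΦ.inv.comp_comul, map_lift2 hΦ.inv.bal2]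
    simp only [lift2_mk2 hG.bal2]
    rw [map_lift2 ?_]
    · simp only [lift2_mk2 hΦ.bal2, apply_invL]
    · exact bal2_mk2_map (u := (G.comp hΦ.invL).toLinearMap) (v := hΦ.invL.toLinearMap) hΦ.invB
        (fun a x => by
          simp only [AlgHom.toLinearMap_apply, AlgHom.comp_apply, map_mul, hΦ.inv.comp_t,
            hG.map_t])
        (fun a x => by simp only [AlgHom.toLinearMap_apply, map_mul, hΦ.inv.comp_s])

theorem isRTrans_conj {F : L →ₐ[k] L} {χ : B ≃ₐ[k] B} (hF : IsRTrans st cop F χ) :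
    IsRTrans st cop (Φ.comp (F.comp hΦ.invL)) ((AlgEquiv.ofBijective φ hΦ.bijB).symm.trans
      (χ.trans (AlgEquiv.ofBijective φ hΦ.bijB))) where
  map_s b := by simp only [AlgHom.comp_apply, hΦ.inv.comp_s, hF.map_s, hΦ.comp_s, apply_invB]
  map_t b := by
    simp only [AlgHom.comp_apply, hΦ.inv.comp_t, hF.map_t, hΦ.comp_t]
    rfl
  map_comul X := by
    simp only [AlgHom.comp_apply]
    rw [hΦ.comp_comul, hF.map_comul, hΦ.inv.comp_comul, map_lift2 hΦ.inv.bal2]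
    simp only [lift2_mk2 hF.bal2]
    rw [map_lift2 ?_]
    · simp only [lift2_mk2 hΦ.bal2, apply_invL]
    · exact bal2_mk2_map (u := hΦ.invL.toLinearMap) (v := (F.comp hΦ.invL).toLinearMap) hΦ.invB
        (fun a x => by simp only [AlgHom.toLinearMap_apply, map_mul, hΦ.inv.comp_t])
        (fun a x => by
          simp only [AlgHom.toLinearMap_apply, AlgHom.comp_apply, map_mul, hΦ.inv.comp_s,
            hF.map_s])

/-- The tautological action `φ ∘ σ ∘ Φ⁻¹` of an automorphism on a linear map. -/
noncomputable def actOn (σ : L →ₗ[k] B) : L →ₗ[k] B :=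
  φ.toLinearMap ∘ₗ σ ∘ₗ hΦ.invL.toLinearMap

theorem actOn_apply (σ : L →ₗ[k] B) (X : L) : hΦ.actOn σ X = φ (σ (hΦ.invL X)) := rfl

theorem actOn_eq_counit (hbgd : st.IsLeftBialgebroid cop cou) {σ : L →ₗ[k] B}
    (hσ : st.IsLeftBisection σ) (X : L) :
    hΦ.actOn σ X = cou (Φ.comp ((hσ.leftTrans hbgd).comp hΦ.invL) X) := by
  rw [actOn_apply, AlgHom.comp_apply, hΦ.comp_counit, AlgHom.comp_apply, hσ.counit_leftTrans]

theorem isLeftBisection_actOn (hbgd : st.IsLeftBialgebroid cop cou) {σ : L →ₗ[k] B}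
    (hσ : st.IsLeftBisection σ) : st.IsLeftBisection (hΦ.actOn σ) := by
  have h : hΦ.actOn σ = cou ∘ₗ (Φ.comp ((hσ.leftTrans hbgd).comp hΦ.invL)).toLinearMap :=
    LinearMap.ext (hΦ.actOn_eq_counit hbgd hσ)
  rw [h]
  exact (hΦ.isLTrans_conj (hσ.isLTrans hbgd)).isLeftBisection hbgd

theorem leftTrans_actOn (hbgd : st.IsLeftBialgebroid cop cou) {σ : L →ₗ[k] B}
    (hσ : st.IsLeftBisection σ) :
    (hΦ.isLeftBisection_actOn hbgd hσ).leftTrans hbgd =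
      Φ.comp ((hσ.leftTrans hbgd).comp hΦ.invL) :=
  IsLeftBisection.leftTrans_eq _ hbgd (hΦ.isLTrans_conj (hσ.isLTrans hbgd))
    (hΦ.actOn_eq_counit hbgd hσ)

theorem base_actOn (hbgd : st.IsLeftBialgebroid cop cou) {σ : L →ₗ[k] B}
    (hσ : st.IsLeftBisection σ) (b : B) :
    (hΦ.isLeftBisection_actOn hbgd hσ).base b = φ (hσ.base (hΦ.invB b)) := by
  rw [IsLeftBisection.base_apply, actOn_apply, hΦ.inv.comp_s, IsLeftBisection.base_apply hσ]

theorem rightTrans_actOn (hbgd : st.IsLeftBialgebroid cop cou) (hHopf : st.IsLeftHopf cop)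
    {σ : L →ₗ[k] B} (hσ : st.IsLeftBisection σ) :
    (hΦ.isLeftBisection_actOn hbgd hσ).rightTrans hbgd hHopf =
      Φ.comp ((hσ.rightTrans hbgd hHopf).comp hΦ.invL) :=
  IsLeftBisection.rightTrans_eq _ hbgd hHopf (IsLeftBisection.leftTrans_bijective _ hbgd hHopf).2
    (hΦ.isRTrans_conj (hσ.isRTrans hbgd hHopf)) fun X => by
      rw [base_actOn hΦ hbgd hσ, actOn_apply, AlgHom.comp_apply, invL_apply, AlgHom.comp_apply,
        hσ.apply_rightTrans, hΦ.inv.comp_counit]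

end IsBgdAut

/-- The group of automorphisms of a left bialgebroid. -/
noncomputable abbrev autGroup (st : BgdST k B L) (cop : L →ₗ[k] st.T2) (cou : L →ₗ[k] B) :
    Group {p : (L →ₐ[k] L) × (B →ₐ[k] B) // st.IsBgdAut cop cou p.1 p.2} :=
  letI : Mul {p : (L →ₐ[k] L) × (B →ₐ[k] B) // st.IsBgdAut cop cou p.1 p.2} :=
    ⟨fun A A' => ⟨(A.1.1.comp A'.1.1, A.1.2.comp A'.1.2), A.2.comp A'.2⟩⟩
  letI : Inv {p : (L →ₐ[k] L) × (B →ₐ[k] B) // st.IsBgdAut cop cou p.1 p.2} :=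
    ⟨fun A => ⟨(A.2.invL, A.2.invB), A.2.inv⟩⟩
  letI : One {p : (L →ₐ[k] L) × (B →ₐ[k] B) // st.IsBgdAut cop cou p.1 p.2} :=
    ⟨⟨(AlgHom.id k L, AlgHom.id k B), .id⟩⟩
  Group.ofLeftAxioms (fun _ _ _ => rfl) (fun _ => rfl) fun A =>
    Subtype.ext (Prod.ext (AlgHom.ext A.2.invL_apply) (AlgHom.ext A.2.invB_apply))

end BgdST

/-- For a left Hopf algebroid `L` over `B`, the map
`Ad^L : B^∨(L) → Aut(L)`, `σ ↦ (Ad^L_σ, σ∘s)`, together with the tautological action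
`(Φ,φ) ▷ σ = φ∘σ∘Φ⁻¹` of `Aut(L)` on the group `B^∨(L)` of left bisections, makes
`(B^∨(L), Aut(L))` a 2-group (group crossed module). -/
theorem bisections_automorphisms_two_group
    {k : Type*} [Field k] {B L : Type*} [Ring B] [Algebra k B] [Ring L] [Algebra k L]
    (st : BgdST k B L) (cop : L →ₗ[k] st.T2) (cou : L →ₗ[k] B)
    (hbgd : st.IsLeftBialgebroid cop cou) (hHopf : st.IsLeftHopf cop) :
    ∃ (m1 : {σ : L →ₗ[k] B // st.IsLeftBisection σ} → {σ : L →ₗ[k] B // st.IsLeftBisection σ} →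
        {σ : L →ₗ[k] B // st.IsLeftBisection σ})
      (i1 : {σ : L →ₗ[k] B // st.IsLeftBisection σ} → {σ : L →ₗ[k] B // st.IsLeftBisection σ})
      (e1 : {σ : L →ₗ[k] B // st.IsLeftBisection σ})
      (m2 : {p : (L →ₐ[k] L) × (B →ₐ[k] B) // st.IsBgdAut cop cou p.1 p.2} →
        {p : (L →ₐ[k] L) × (B →ₐ[k] B) // st.IsBgdAut cop cou p.1 p.2} →
        {p : (L →ₐ[k] L) × (B →ₐ[k] B) // st.IsBgdAut cop cou p.1 p.2})
      (i2 : {p : (L →ₐ[k] L) × (B →ₐ[k] B) // st.IsBgdAut cop cou p.1 p.2} →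
        {p : (L →ₐ[k] L) × (B →ₐ[k] B) // st.IsBgdAut cop cou p.1 p.2})
      (e2 : {p : (L →ₐ[k] L) × (B →ₐ[k] B) // st.IsBgdAut cop cou p.1 p.2})
      (μ : {σ : L →ₗ[k] B // st.IsLeftBisection σ} →
        {p : (L →ₐ[k] L) × (B →ₐ[k] B) // st.IsBgdAut cop cou p.1 p.2})
      (act : {p : (L →ₐ[k] L) × (B →ₐ[k] B) // st.IsBgdAut cop cou p.1 p.2} →
        {σ : L →ₗ[k] B // st.IsLeftBisection σ} → {σ : L →ₗ[k] B // st.IsLeftBisection σ}),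
      -- the group of left bisections with the convolution product
      (∀ σ η, (m1 σ η).1 = st.bconv cop σ.1 η.1) ∧ e1.1 = cou ∧
      -- the automorphism group with composition
      (∀ A A', ((m2 A A').1.1 : L →ₐ[k] L) = A.1.1.comp A'.1.1 ∧
        ((m2 A A').1.2 : B →ₐ[k] B) = A.1.2.comp A'.1.2) ∧
      (e2.1.1 = AlgHom.id k L ∧ e2.1.2 = AlgHom.id k B) ∧
      -- μ is σ ↦ (Ad^L_σ, σ∘s)
      (∀ σ, (∀ X : L, (μ σ).1.1 X = st.adL cop σ.1 X) ∧
        (∀ b : B, (μ σ).1.2 b = σ.1 (st.s b))) ∧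
      -- act is the tautological action (Φ,φ) ▷ σ = φ ∘ σ ∘ Φ⁻¹
      (∀ A σ, ⇑(act A σ).1 = ⇑A.1.2 ∘ ⇑σ.1 ∘ Function.invFun ⇑A.1.1) ∧
      -- group laws
      (∀ a b c, m1 (m1 a b) c = m1 a (m1 b c)) ∧
      (∀ a, m1 e1 a = a ∧ m1 a e1 = a ∧ m1 a (i1 a) = e1 ∧ m1 (i1 a) a = e1) ∧
      (∀ a b c, m2 (m2 a b) c = m2 a (m2 b c)) ∧
      (∀ a, m2 e2 a = a ∧ m2 a e2 = a ∧ m2 a (i2 a) = e2 ∧ m2 (i2 a) a = e2) ∧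
      -- μ is a group morphism
      (∀ σ η, μ (m1 σ η) = m2 (μ σ) (μ η)) ∧
      -- ▷ is a left action by group automorphisms
      (∀ σ, act e2 σ = σ) ∧
      (∀ A A' σ, act (m2 A A') σ = act A (act A' σ)) ∧
      (∀ A σ η, act A (m1 σ η) = m1 (act A σ) (act A η)) ∧
      -- 2-group (crossed module) identities
      (∀ A σ, μ (act A σ) = m2 (m2 A (μ σ)) (i2 A)) ∧
      (∀ σ η, act (μ σ) η = m1 (m1 σ η) (i1 σ)) := by
  let _ := BgdST.bisectionGroup hbgd hHopf
  let _ := BgdST.autGroup st cop cou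
  refine ⟨(· * ·), (·⁻¹), 1, (· * ·), (·⁻¹), 1,
    fun σ => ⟨((σ.2.leftTrans hbgd).comp (σ.2.rightTrans hbgd hHopf), σ.2.base),
      σ.2.isBgdAut hbgd hHopf⟩,
    fun A σ => ⟨A.2.actOn σ.1, A.2.isLeftBisection_actOn hbgd σ.2⟩,
    fun _ _ => rfl, rfl, fun _ _ => ⟨rfl, rfl⟩, ⟨rfl, rfl⟩,
    fun σ => ⟨fun X => (σ.2.adL_eq hbgd hHopf X).symm, fun _ => rfl⟩, fun A σ => ?_,
    mul_assoc, fun a => ⟨one_mul a, mul_one a, mul_inv_cancel a, inv_mul_cancel a⟩,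
    mul_assoc, fun a => ⟨one_mul a, mul_one a, mul_inv_cancel a, inv_mul_cancel a⟩,
    fun σ η => ?_, fun σ => ?_, fun A A' σ => ?_, fun A σ η => ?_, fun A σ => ?_, fun σ η => ?_⟩
  · funext X
    obtain ⟨X, rfl⟩ := A.2.bijL.2 X
    simp only [Function.comp_apply, Function.leftInverse_invFun A.2.bijL.1 X]
    rw [A.2.actOn_apply, A.2.invL_apply]
  · refine Subtype.ext (Prod.ext (AlgHom.ext fun X => ?_) (AlgHom.ext fun b => ?_))
    · change (σ.2.bconv η.2 hbgd).leftTrans hbgd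
        ((σ.2.bconv η.2 hbgd).rightTrans hbgd hHopf X) = σ.2.leftTrans hbgd
          (σ.2.rightTrans hbgd hHopf (η.2.leftTrans hbgd (η.2.rightTrans hbgd hHopf X)))
      rw [σ.2.leftTrans_bconv η.2, σ.2.rightTrans_bconv η.2, AlgHom.comp_apply,
        AlgHom.comp_apply, (η.2.isLTrans hbgd).commute hbgd (σ.2.isRTrans hbgd hHopf)]
    · exact σ.2.base_bconv η.2 hbgd b
  · refine Subtype.ext (LinearMap.ext fun X => ?_)
    exact congrArg σ.1 ((BgdST.IsBgdAut.id (st := st) (cop := cop) (cou := cou)).invL_apply X)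
  · refine Subtype.ext (LinearMap.ext fun X => ?_)
    obtain ⟨Y, rfl⟩ := A.2.bijL.2 X
    obtain ⟨X, rfl⟩ := A'.2.bijL.2 Y
    change A.1.2 (A'.1.2 (σ.1 ((A.2.comp A'.2).invL (A.1.1.comp A'.1.1 X)))) =
      A.1.2 (A'.1.2 (σ.1 (A'.2.invL (A.2.invL (A.1.1 (A'.1.1 X))))))
    rw [(A.2.comp A'.2).invL_apply, A.2.invL_apply, A'.2.invL_apply]
  · refine Subtype.ext (LinearMap.ext fun X => ?_)
    change A.2.actOn (st.bconv cop σ.1 η.1) X = st.bconv cop (A.2.actOn σ.1) (A.2.actOn η.1) X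
    rw [(A.2.isLeftBisection_actOn hbgd η.2).bconv_apply hbgd,
      A.2.leftTrans_actOn hbgd η.2, A.2.actOn_apply, A.2.actOn_apply, AlgHom.comp_apply,
      A.2.invL_apply, η.2.bconv_apply hbgd, AlgHom.comp_apply]
  · refine Subtype.ext (Prod.ext (AlgHom.ext fun X => ?_) (AlgHom.ext fun b => ?_))
    · change (A.2.isLeftBisection_actOn hbgd σ.2).leftTrans hbgd
        ((A.2.isLeftBisection_actOn hbgd σ.2).rightTrans hbgd hHopf X) =
          A.1.1 (σ.2.leftTrans hbgd (σ.2.rightTrans hbgd hHopf (A.2.invL X)))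
      rw [A.2.leftTrans_actOn hbgd σ.2, A.2.rightTrans_actOn hbgd hHopf σ.2]
      simp only [AlgHom.comp_apply, A.2.invL_apply]
    · exact A.2.base_actOn hbgd σ.2 b
  · refine eq_mul_inv_of_mul_eq (Subtype.ext (LinearMap.ext fun X => ?_))
    obtain ⟨X, rfl⟩ := (σ.2.rightTrans_bijective hbgd hHopf).2 X
    have hA := σ.2.isBgdAut hbgd hHopf
    change st.bconv cop (hA.actOn η.1) σ.1 _ = st.bconv cop σ.1 η.1 _
    rw [σ.2.bconv_apply hbgd, η.2.bconv_apply hbgd,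
      ← (η.2.isLTrans hbgd).commute hbgd (σ.2.isRTrans hbgd hHopf), σ.2.apply_rightTrans,
      η.2.counit_leftTrans, hA.actOn_apply]
    exact congrArg (fun Y => σ.2.base (η.1 Y)) (hA.invL_apply X)
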